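/- arXiv:2003.08497 — 5 statements merged into one kernel-verified Lean document; each statement's English description precedes it below -/
import Mathlib

section
/- For all real numbers C > 0 and γ > 2 there exists N such that for every n ≥ N the following holds: if d is a nontrivial graphical degree sequence of length n such that, for every integer i ≥ 1, the number of indices j with d_j ≥ i is at most C·n·F_γ(i), where F_γ(i) = Σ_{ℓ ≥ i} ℓ^{−γ}, then d is (8,8)-stable. -/
open Finset

/-- The degree of vertex `i` in the simple graph `G`. -/
noncomputable def degOf {n : ℕ} (G : SimpleGraph (Fin n)) (i : Fin n) : ℕ :=
  (G.neighborSet i).ncard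

/-- `Omega d` is the set of simple graphs on `{1,…,n}` with degree sequence `d`. -/
def Omega {n : ℕ} (d : Fin n → ℕ) : Set (SimpleGraph (Fin n)) :=
  {G | ∀ i, degOf G i = d i}

/-- A degree sequence is graphical if it is realised by some simple graph. -/
def Graphical {n : ℕ} (d : Fin n → ℕ) : Prop := (Omega d).Nonempty

/-- `M(d)`, the sum of the entries of `d`. -/
def Mdeg {n : ℕ} (d : Fin n → ℕ) : ℕ := ∑ i, d i

/-- `Δ(d)`, the maximum entry of `d`. -/
def Δdeg {n : ℕ} (d : Fin n → ℕ) : ℕ := Finset.univ.sup d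

/-- The sum of the `k` largest entries of `d`, expressed as the maximum of the
sum of `d` over the subsets of size `k`. -/
def sumLargest {n : ℕ} (k : ℕ) (d : Fin n → ℕ) : ℕ :=
  (Finset.univ.powersetCard k).sup (fun S => ∑ i ∈ S, d i)

/-- `J(d)`, the sum of the `Δ(d)` largest entries of `d`. -/
def Jdeg {n : ℕ} (d : Fin n → ℕ) : ℕ := sumLargest (Δdeg d) d

/-- The ℓ₁ distance between two degree sequences. -/
def l1dist {n : ℕ} (d d' : Fin n → ℕ) : ℕ := ∑ i, ((d i : ℤ) - (d' i : ℤ)).natAbs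

/-- A graphical degree sequence `d` is `(k,α)`-stable if `|Ω(d')| ≤ M(d)^α |Ω(d)|`
for every graphical `d'` with `‖d' - d‖₁ ≤ k`. -/
def Stable {n : ℕ} (k : ℕ) (α : ℝ) (d : Fin n → ℕ) : Prop :=
  ∀ d' : Fin n → ℕ, Graphical d' → l1dist d' d ≤ k →
    ((Omega d').ncard : ℝ) ≤ (Mdeg d : ℝ) ^ α * ((Omega d).ncard : ℝ)

/-- `Ω'(d)`: union of `Ω(d')` over graphical `d' ≤ d` with `‖d - d'‖₁ ≤ 2`. -/
def OmegaPrime {n : ℕ} (d : Fin n → ℕ) : Set (SimpleGraph (Fin n)) :=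
  ⋃ d' ∈ {d' : Fin n → ℕ | Graphical d' ∧ (∀ j, d' j ≤ d j) ∧ l1dist d d' ≤ 2},
    Omega d'


/-- `F_γ(i) = ∑_{ℓ ≥ i} ℓ^(-γ)`. -/
noncomputable def Fpow (γ : ℝ) (i : ℕ) : ℝ :=
  ∑' ℓ : ℕ, if i ≤ ℓ then (ℓ : ℝ) ^ (-γ) else 0


open Classical in
/-- degree as an integer sum -/
noncomputable def dg {n : ℕ} (G : SimpleGraph (Fin n)) (k : Fin n) : ℤ :=
  ∑ w, if G.Adj k w then 1 else 0

open Classical in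
noncomputable def nb {n : ℕ} (G : SimpleGraph (Fin n)) (k : Fin n) : Finset (Fin n) :=
  univ.filter (fun w => G.Adj k w)

lemma mem_nb {n : ℕ} (G : SimpleGraph (Fin n)) (k w : Fin n) : w ∈ nb G k ↔ G.Adj k w := by
  simp [nb]

lemma card_nb {n : ℕ} (G : SimpleGraph (Fin n)) (k : Fin n) : ((nb G k).card : ℤ) = dg G k := by
  classical
  simp [nb, dg]

lemma degOf_eq {n : ℕ} (G : SimpleGraph (Fin n)) (k : Fin n) : (degOf G k : ℤ) = dg G k := by
  rw [← card_nb, degOf, ← Set.ncard_coe_finset]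
  congr 2
  ext w
  simp [mem_nb]

lemma dg_nonneg {n : ℕ} (G : SimpleGraph (Fin n)) (k : Fin n) : 0 ≤ dg G k := by
  rw [← card_nb]; positivity

/-- unit vector -/
def ee {n : ℕ} (i : Fin n) : Fin n → ℤ := fun k => if k = i then 1 else 0

lemma sum_ee {n : ℕ} (i : Fin n) : ∑ k, ee i k = 1 := by
  simp [ee]

lemma dg_add {n : ℕ} (G : SimpleGraph (Fin n)) (i v : Fin n) (hne : i ≠ v) (h : ¬ G.Adj i v) :
    dg (G ⊔ SimpleGraph.edge i v) = dg G + ee i + ee v := by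
  classical
  ext k
  have h1 : dg (G ⊔ SimpleGraph.edge i v) k = ∑ w, ((if G.Adj k w then (1:ℤ) else 0)
      + (if w = v then ee i k else 0) + (if w = i then ee v k else 0)) := by
    unfold dg
    apply Finset.sum_congr rfl
    intro w _
    simp only [SimpleGraph.sup_adj, SimpleGraph.edge_adj, ee]
    have := G.adj_comm i v
    grind
  rw [h1]
  simp only [Finset.sum_add_distrib, Pi.add_apply]
  simp [dg]

lemma sup_sdiff_edge {n : ℕ} (G : SimpleGraph (Fin n)) (i v : Fin n) (h : ¬ G.Adj i v) :
    (G ⊔ SimpleGraph.edge i v) \ SimpleGraph.edge i v = G := by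
  ext a b
  simp only [SimpleGraph.sup_adj, SimpleGraph.sdiff_adj, SimpleGraph.edge_adj]
  have := G.adj_comm i v
  have := G.loopless
  grind [SimpleGraph.irrefl]

lemma sdiff_sup_edge {n : ℕ} (G : SimpleGraph (Fin n)) (i v : Fin n) (h : G.Adj i v) :
    (G \ SimpleGraph.edge i v) ⊔ SimpleGraph.edge i v = G := by
  ext a b
  simp only [SimpleGraph.sup_adj, SimpleGraph.sdiff_adj, SimpleGraph.edge_adj]
  have := G.adj_comm i v
  grind

lemma dg_del {n : ℕ} (G : SimpleGraph (Fin n)) (i v : Fin n) (h : G.Adj i v) :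
    dg (G \ SimpleGraph.edge i v) = dg G - ee i - ee v := by
  have h2 := dg_add (G \ SimpleGraph.edge i v) i v h.ne (by
    simp [SimpleGraph.sdiff_adj, SimpleGraph.edge_adj, h.ne])
  rw [sdiff_sup_edge G i v h] at h2
  rw [h2]; abel

open Classical in
noncomputable def Om {n : ℕ} (f : Fin n → ℤ) : Finset (SimpleGraph (Fin n)) :=
  univ.filter (fun G => dg G = f)

lemma mem_Om {n : ℕ} (f : Fin n → ℤ) (G : SimpleGraph (Fin n)) : G ∈ Om f ↔ dg G = f := by
  simp [Om]

noncomputable def NN {n : ℕ} (f : Fin n → ℤ) : ℤ := ((Om f).card : ℤ)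

lemma NN_nonneg {n : ℕ} (f : Fin n → ℤ) : 0 ≤ NN f := by unfold NN; positivity

lemma Omega_ncard {n : ℕ} (d : Fin n → ℕ) : ((Omega d).ncard : ℤ) = NN (fun i => (d i : ℤ)) := by
  rw [NN, ← Set.ncard_coe_finset]
  congr 2
  ext G
  simp only [Omega, Set.mem_ofPred_eq, Finset.mem_coe, mem_Om]
  constructor
  · intro h; ext k; rw [← degOf_eq, h]
  · intro h k
    have := congrFun h k
    rw [← degOf_eq] at this
    exact_mod_cast this

lemma del_bound {n : ℕ} (f : Fin n → ℤ) (i : Fin n) (hi : 1 ≤ f i) :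
    NN f ≤ ∑ v, NN (f - ee i - ee v) := by
  classical
  have key : ∀ G ∈ Om f, ∃ v, G.Adj i v := by
    intro G hG
    rw [mem_Om] at hG
    have h1 : 0 < (nb G i).card := by
      have := card_nb G i
      rw [hG] at this
      omega
    obtain ⟨v, hv⟩ := Finset.card_pos.1 h1
    exact ⟨v, (mem_nb _ _ _).1 hv⟩
  let c : SimpleGraph (Fin n) → Fin n := fun G => if h : ∃ v, G.Adj i v then h.choose else i
  have hc : ∀ G ∈ Om f, G.Adj i (c G) := by
    intro G hG
    have h := key G hG
    simp only [c, dif_pos h]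
    exact h.choose_spec
  have := Finset.card_le_card_of_injOn (s := Om f)
    (t := (univ : Finset (Fin n)).sigma (fun v => Om (f - ee i - ee v)))
    (fun G => ⟨c G, G \ SimpleGraph.edge i (c G)⟩) (by
      intro G hG
      simp only [Finset.coe_sigma, Set.mem_sigma_iff, Finset.mem_coe, Finset.mem_univ, true_and]
      rw [mem_Om, dg_del _ _ _ (hc G hG), (mem_Om _ _).1 hG]) (by
      intro G hG G' hG' heq
      simp only [Sigma.mk.injEq, heq_eq_eq] at heq
      obtain ⟨h1, h2⟩ := heq
      rw [← sdiff_sup_edge G i (c G) (hc G hG), h2, h1, sdiff_sup_edge G' i (c G') (hc G' hG')])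
  rw [Finset.card_sigma] at this
  unfold NN
  exact_mod_cast this

open Classical in
/-- good ordered edges -/
noncomputable def good {n : ℕ} (G : SimpleGraph (Fin n)) (x y : Fin n) :
    Finset (Fin n × Fin n) :=
  univ.filter (fun p => G.Adj p.1 p.2 ∧ p.1 ≠ x ∧ ¬ G.Adj p.1 x ∧ p.2 ≠ y ∧ ¬ G.Adj p.2 y)

lemma good_card {n : ℕ} (G : SimpleGraph (Fin n)) (x y : Fin n) (B : ℤ)
    (hB : ∀ S : Finset (Fin n), (∃ z, (S.card : ℤ) ≤ dg G z + 1) → ∑ s ∈ S, dg G s ≤ B) :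
    ∑ k, dg G k ≤ (good G x y).card + 2 * B := by
  classical
  have h1 : ∑ k, dg G k = ((univ.filter (fun p : Fin n × Fin n => G.Adj p.1 p.2)).card : ℤ) := by
    rw [Finset.card_filter]
    push_cast
    rw [Fintype.sum_prod_type]
    rfl
  have hS : ∀ z, ∑ s ∈ insert z (nb G z), dg G s ≤ B := by
    intro z
    apply hB
    refine ⟨z, ?_⟩
    have := Finset.card_insert_le z (nb G z)
    have := card_nb G z
    omega
  have h2 : (univ.filter (fun p : Fin n × Fin n => G.Adj p.1 p.2)) ⊆
      good G x y ∪ (((insert x (nb G x)).sigma (fun a => nb G a)).image (fun q => (q.1, q.2))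
        ∪ ((insert y (nb G y)).sigma (fun a => nb G a)).image (fun q => (q.2, q.1))) := by
    rintro ⟨a, b⟩ hab
    simp only [Finset.mem_filter, Finset.mem_univ, true_and] at hab
    simp only [good, Finset.mem_union, Finset.mem_image, Finset.mem_sigma, Finset.mem_insert,
      mem_nb, Finset.mem_filter, Finset.mem_univ, true_and, Prod.mk.injEq, Sigma.exists]
    by_cases ha : a = x ∨ G.Adj x a
    · right; left
      exact ⟨a, b, ⟨ha, hab⟩, rfl, rfl⟩
    by_cases hb : b = y ∨ G.Adj y b
    · right; right
      exact ⟨b, a, ⟨hb, hab.symm⟩, rfl, rfl⟩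
    left
    push Not at ha hb
    exact ⟨hab, ha.1, fun h => ha.2 h.symm, hb.1, fun h => hb.2 h.symm⟩
  have h3 := Finset.card_le_card h2
  have h4 := Finset.card_union_le (good G x y)
    (((insert x (nb G x)).sigma (fun a => nb G a)).image (fun q => (q.1, q.2))
        ∪ ((insert y (nb G y)).sigma (fun a => nb G a)).image (fun q => (q.2, q.1)))
  have h5 := Finset.card_union_le
    (((insert x (nb G x)).sigma (fun a => nb G a)).image (fun q => (q.1, q.2)))
    (((insert y (nb G y)).sigma (fun a => nb G a)).image (fun q => (q.2, q.1)))
  have h6 : ((((insert x (nb G x)).sigma (fun a => nb G a)).image (fun q => (q.1, q.2))).card : ℤ)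
      ≤ B := by
    refine le_trans ?_ (hS x)
    refine le_trans (Nat.cast_le.2 Finset.card_image_le) ?_
    rw [Finset.card_sigma]; push_cast; simp only [card_nb]; exact le_rfl
  have h7 : ((((insert y (nb G y)).sigma (fun a => nb G a)).image (fun q => (q.2, q.1))).card : ℤ)
      ≤ B := by
    refine le_trans ?_ (hS y)
    refine le_trans (Nat.cast_le.2 Finset.card_image_le) ?_
    rw [Finset.card_sigma]; push_cast; simp only [card_nb]; exact le_rfl
  rw [h1]
  omega

def sw {n : ℕ} (x y : Fin n) (G : SimpleGraph (Fin n)) (p : Fin n × Fin n) :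
    SimpleGraph (Fin n) :=
  ((G \ SimpleGraph.edge p.1 p.2) ⊔ SimpleGraph.edge p.1 x) ⊔ SimpleGraph.edge p.2 y

lemma sw_nadj {n : ℕ} (G : SimpleGraph (Fin n)) (x y a b : Fin n) (hab : G.Adj a b)
    (hax : a ≠ x) (hnax : ¬ G.Adj a x) (hby : b ≠ y) (hnby : ¬ G.Adj b y) :
    ¬ ((G \ SimpleGraph.edge a b) ⊔ SimpleGraph.edge a x).Adj b y := by
  simp only [SimpleGraph.sup_adj, SimpleGraph.sdiff_adj, SimpleGraph.edge_adj]
  have := G.adj_comm a b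
  have := hab.ne
  grind

lemma sw_inv {n : ℕ} (G : SimpleGraph (Fin n)) (x y a b : Fin n) (hab : G.Adj a b)
    (hax : a ≠ x) (hnax : ¬ G.Adj a x) (hby : b ≠ y) (hnby : ¬ G.Adj b y) :
    ((sw x y G (a, b) \ SimpleGraph.edge b y) \ SimpleGraph.edge a x) ⊔ SimpleGraph.edge a b
      = G := by
  unfold sw
  rw [sup_sdiff_edge _ _ _ (sw_nadj G x y a b hab hax hnax hby hnby), sup_sdiff_edge,
    sdiff_sup_edge _ _ _ hab]
  simp only [SimpleGraph.sdiff_adj]; tauto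

lemma core_bound {n : ℕ} (h : Fin n → ℤ) (x y : Fin n) (K : ℤ)
    (hK : ∀ G ∈ Om h, K ≤ (good G x y).card) :
    K * NN h ≤ (h + ee x + ee y) x * (h + ee x + ee y) y * NN (h + ee x + ee y) := by
  classical
  set f := h + ee x + ee y with hf
  have := Finset.card_le_card_of_injOn (s := (Om h).sigma (fun G => good G x y))
    (t := (Om f).sigma (fun G => nb G x ×ˢ nb G y))
    (fun q => ⟨sw x y q.1 q.2, q.2⟩) (by
      rintro ⟨G, a, b⟩ hq
      simp only [good, Finset.coe_sigma, Set.mem_sigma_iff, Finset.mem_coe, mem_Om,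
        Finset.mem_filter, Finset.mem_univ, true_and] at hq
      obtain ⟨hG, hab, hax, hnax, hby, hnby⟩ := hq
      simp only [Finset.coe_sigma, Set.mem_sigma_iff, Finset.mem_coe, mem_Om,
        Finset.mem_product, mem_nb]
      refine ⟨?_, ?_, ?_⟩
      · unfold sw
        rw [dg_add _ _ _ hby, dg_add _ _ _ hax, dg_del _ _ _ hab, hG, hf]
        · abel
        · simp only [SimpleGraph.sdiff_adj]; tauto
        · exact sw_nadj G x y a b hab hax hnax hby hnby
      · simp only [sw, SimpleGraph.sup_adj, SimpleGraph.edge_adj]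
        grind
      · simp only [sw, SimpleGraph.sup_adj, SimpleGraph.edge_adj]
        grind) (by
      rintro ⟨G, a, b⟩ hq ⟨G', a', b'⟩ hq' heq
      simp only [good, Finset.coe_sigma, Set.mem_sigma_iff, Finset.mem_coe, mem_Om,
        Finset.mem_filter, Finset.mem_univ, true_and] at hq hq'
      simp only [Sigma.mk.injEq, heq_eq_eq, Prod.mk.injEq] at heq
      obtain ⟨h1, rfl, rfl⟩ := heq
      obtain ⟨hG, hab, hax, hnax, hby, hnby⟩ := hq
      obtain ⟨hG', hab', hax', hnax', hby', hnby'⟩ := hq'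
      have : G = G' := by
        rw [← sw_inv G x y a b hab hax hnax hby hnby, h1,
          sw_inv G' x y a b hab' hax' hnax' hby' hnby']
      subst this
      rfl)
  rw [Finset.card_sigma, Finset.card_sigma] at this
  have e1 : K * NN h ≤ ∑ G ∈ Om h, ((good G x y).card : ℤ) := by
    have := Finset.sum_le_sum hK
    simp only [Finset.sum_const, nsmul_eq_mul] at this
    unfold NN
    rw [mul_comm]
    exact this
  have e2 : ∑ G ∈ Om f, ((nb G x ×ˢ nb G y).card : ℤ) = f x * f y * NN f := by
    have : ∀ G ∈ Om f, ((nb G x ×ˢ nb G y).card : ℤ) = f x * f y := by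
      intro G hG
      rw [Finset.card_product]; push_cast
      rw [card_nb, card_nb, (mem_Om _ _).1 hG]
    rw [Finset.sum_congr rfl this]
    simp [NN, mul_comm]
  rw [← e2]
  refine e1.trans ?_
  exact_mod_cast this

def dist1 {n : ℕ} (f g : Fin n → ℤ) : ℤ := ∑ k, |f k - g k|

/-- The combinatorial smallness condition. -/
def SmallD {n : ℕ} (d : Fin n → ℤ) : Prop :=
  (∀ S : Finset (Fin n), (∃ z, (S.card : ℤ) ≤ d z + 13) → 4 * ∑ s ∈ S, d s + 200 ≤ ∑ k, d k)
  ∧ (∀ k, 1 ≤ d k) ∧ 200 ≤ ∑ k, d k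

lemma dist1_ge {n : ℕ} (f g : Fin n → ℤ) (S : Finset (Fin n)) :
    |∑ s ∈ S, f s - ∑ s ∈ S, g s| ≤ dist1 f g := by
  rw [← Finset.sum_sub_distrib]
  refine (Finset.abs_sum_le_sum_abs _ _).trans ?_
  exact Finset.sum_le_sum_of_subset_of_nonneg (Finset.subset_univ _) (fun _ _ _ => abs_nonneg _)

lemma dist1_ge' {n : ℕ} (f g : Fin n → ℤ) (k : Fin n) : |f k - g k| ≤ dist1 f g := by
  simpa using dist1_ge f g {k}

lemma core2 {n : ℕ} (d h : Fin n → ℤ) (hd : SmallD d) (x y : Fin n) (hh : dist1 h d ≤ 12) :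
    2 * NN h ≤ (h + ee x + ee y) x * (h + ee x + ee y) y * NN (h + ee x + ee y) := by
  apply core_bound
  intro G hG
  rw [mem_Om] at hG
  have hM := dist1_ge h d univ
  rw [abs_le] at hM
  have := good_card G x y ((∑ k, h k - 2) / 2) (by
    rintro S ⟨z, hz⟩
    rw [hG] at hz ⊢
    have h1 := dist1_ge' h d z
    have h2 := dist1_ge h d S
    rw [abs_le] at h1 h2
    have h3 := hd.1 S ⟨z, by linarith⟩
    have h4 : 0 ≤ ∑ s ∈ S, d s := Finset.sum_nonneg (fun k _ => by linarith [hd.2.1 k])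
    omega)
  rw [hG] at this
  omega

lemma core_all {n : ℕ} (d : Fin n → ℤ) (hd : SmallD d) (f h : Fin n → ℤ) (x y : Fin n)
    (hh : dist1 h d ≤ 12) (hf : h + ee x + ee y = f) :
    2 * NN h ≤ f x * f y * NN f := by
  have := core2 d h hd x y hh
  rwa [hf] at this

lemma dist1_ee {n : ℕ} (f d : Fin n → ℤ) (i : Fin n) :
    dist1 (f - ee i) d ≤ dist1 f d + 1 := by
  unfold dist1
  rw [← sum_ee i, ← Finset.sum_add_distrib]
  apply Finset.sum_le_sum
  intro k _
  simp only [Pi.sub_apply, ee]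
  split_ifs
  · have := abs_sub (f k - d k) 1
    rw [abs_one] at this
    rwa [show f k - 1 - d k = f k - d k - 1 by ring]
  · simp

lemma dist1_sub {n : ℕ} (f d : Fin n → ℤ) (i : Fin n) (h : d i < f i) :
    dist1 (f - ee i) d = dist1 f d - 1 := by
  unfold dist1
  rw [← sum_ee i, ← Finset.sum_sub_distrib]
  apply Finset.sum_congr rfl
  intro k _
  simp only [Pi.sub_apply, ee]
  split_ifs with hk
  · subst hk
    rw [abs_of_nonneg (by omega), abs_of_nonneg (by omega)]; ring
  · simp

lemma dist1_add {n : ℕ} (f d : Fin n → ℤ) (i : Fin n) (h : f i < d i) :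
    dist1 (f + ee i) d = dist1 f d - 1 := by
  unfold dist1
  rw [← sum_ee i, ← Finset.sum_sub_distrib]
  apply Finset.sum_congr rfl
  intro k _
  simp only [Pi.add_apply, ee]
  split_ifs with hk
  · subst hk
    rw [abs_of_nonpos (by omega), abs_of_nonpos (by omega)]; ring
  · simp

lemma le_sum_of_NN {n : ℕ} (f : Fin n → ℤ) (j : Fin n) :
    f j * NN f ≤ (∑ k, f k) * NN f := by
  rcases Finset.eq_empty_or_nonempty (Om f) with h | ⟨G, hG⟩
  · simp [NN, h]
  · rw [mem_Om] at hG
    apply mul_le_mul_of_nonneg_right _ (NN_nonneg f)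
    exact Finset.single_le_sum (f := f) (fun k _ => by rw [← hG]; exact dg_nonneg G k)
      (Finset.mem_univ j)

lemma le_sum_of_NN2 {n : ℕ} (f : Fin n → ℤ) (i j : Fin n) :
    f i * f j * NN f ≤ (∑ k, f k) ^ 2 * NN f := by
  rcases Finset.eq_empty_or_nonempty (Om f) with h | ⟨G, hG⟩
  · simp [NN, h]
  · rw [mem_Om] at hG
    apply mul_le_mul_of_nonneg_right _ (NN_nonneg f)
    have h0 : ∀ k, 0 ≤ f k := fun k => by rw [← hG]; exact dg_nonneg G k
    have h1 : ∀ j, f j ≤ ∑ k, f k := fun j =>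
      Finset.single_le_sum (f := f) (fun k _ => h0 k) (Finset.mem_univ j)
    nlinarith [h1 i, h1 j, h0 i, h0 j, mul_le_mul (h1 i) (h1 j) (h0 j) ((h0 i).trans (h1 i))]

/-- lower at i and raise at j -/
lemma type_c {n : ℕ} (d g : Fin n → ℤ) (hd : SmallD d) (hg : dist1 g d ≤ 8) (i j : Fin n)
    (hi : d i < g i) :
    2 * NN g ≤ (∑ k, (g - ee i + ee j) k) ^ 2 * NN (g - ee i + ee j) := by
  set f := g - ee i + ee j with hf
  have h1 := del_bound g i (by have := hd.2.1 i; omega)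
  have h2 : ∀ v, 2 * NN (g - ee i - ee v) ≤ f v * f j * NN f := by
    intro v
    apply core_all d hd
    · have := dist1_ee g d i
      have := dist1_ee (g - ee i) d v
      linarith
    · rw [hf]; abel
  have h3 := Finset.sum_le_sum (fun v (_ : v ∈ univ) => h2 v)
  rw [← Finset.mul_sum] at h3
  have h4 : ∑ v, f v * f j * NN f = (∑ v, f v) * (f j * NN f) := by
    rw [Finset.sum_mul]; simp [mul_assoc]
  rw [h4] at h3
  have h5 : (∑ v, f v) * (f j * NN f) ≤ (∑ v, f v) ^ 2 * NN f := by
    have h7 : ∑ v, f v * f j * NN f ≤ (∑ v, f v) ^ 2 * NN f := by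
      rcases Finset.eq_empty_or_nonempty (Om f) with h | ⟨G, hG⟩
      · simp [NN, h]
      · rw [h4, pow_two, mul_assoc]
        rw [mem_Om] at hG
        apply mul_le_mul_of_nonneg_left (le_sum_of_NN f j)
        exact Finset.sum_nonneg (fun k _ => by rw [← hG]; exact dg_nonneg G k)
    rwa [h4] at h7
  linarith

lemma type_b {n : ℕ} (d g : Fin n → ℤ) (hd : SmallD d) (hg : dist1 g d ≤ 8) (i j : Fin n) :
    2 * NN g ≤ (∑ k, (g + ee i + ee j) k) ^ 2 * NN (g + ee i + ee j) :=
  (core_all d hd (g + ee i + ee j) g i j (by linarith) rfl).trans (le_sum_of_NN2 _ i j)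

lemma type_a {n : ℕ} (d g : Fin n → ℤ) (hd : SmallD d) (hg : dist1 g d ≤ 8) (i j : Fin n)
    (hi : d i < g i) (hj : d j < (g - ee i) j) :
    2 * NN g ≤ (∑ k, (g - ee i - ee j) k) ^ 2 * NN (g - ee i - ee j) := by
  set f := g - ee i - ee j with hf
  have h1 := del_bound g i (by have := hd.2.1 i; omega)
  have h2 : ∀ u, NN (g - ee i - ee u) ≤ ∑ v, NN (g - ee i - ee u - ee j - ee v) := by
    intro u
    apply del_bound
    have := hd.2.1 j
    have h3 : ee u j ≤ 1 := by unfold ee; split_ifs <;> simp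
    simp only [Pi.sub_apply] at hj ⊢
    omega
  have h3 : ∀ u v, 2 * NN (g - ee i - ee u - ee j - ee v) ≤ f u * f v * NN f := by
    intro u v
    apply core_all d hd
    · have := dist1_ee g d i
      have := dist1_ee (g - ee i) d u
      have := dist1_ee (g - ee i - ee u) d j
      have := dist1_ee (g - ee i - ee u - ee j) d v
      linarith
    · rw [hf]; abel
  calc 2 * NN g ≤ 2 * ∑ u, NN (g - ee i - ee u) := by linarith
    _ ≤ 2 * ∑ u, ∑ v, NN (g - ee i - ee u - ee j - ee v) := by
        have := Finset.sum_le_sum (fun u (_ : u ∈ univ) => h2 u)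
        linarith
    _ = ∑ u, ∑ v, 2 * NN (g - ee i - ee u - ee j - ee v) := by simp only [Finset.mul_sum]
    _ ≤ ∑ u, ∑ v, f u * f v * NN f :=
        Finset.sum_le_sum (fun u _ => Finset.sum_le_sum (fun v _ => h3 u v))
    _ = (∑ k, f k) ^ 2 * NN f := by
        simp only [← Finset.sum_mul, ← Finset.mul_sum]
        ring

lemma dg_even {n : ℕ} (G : SimpleGraph (Fin n)) : Even (∑ k, dg G k) := by
  classical
  have h := G.sum_degrees_eq_twice_card_edges
  have h2 : ∑ k, dg G k = ((∑ v, G.degree v : ℕ) : ℤ) := by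
    push_cast
    apply Finset.sum_congr rfl
    intro k _
    rw [← card_nb]
    congr 2
    ext w
    simp [mem_nb]
  rw [h2, h]
  exact ⟨G.edgeFinset.card, by push_cast; ring⟩

lemma step_sq (s m : ℤ) (hm : 200 ≤ m) (h : |s - m| ≤ 8) : s ^ 2 ≤ 2 * m ^ 2 := by
  rw [abs_le] at h
  nlinarith

lemma main_ind {n : ℕ} (d : Fin n → ℤ) (hd : SmallD d) (hne : (Om d).Nonempty) (k : ℕ) :
    ∀ g : Fin n → ℤ, dist1 g d ≤ 2 * k → k ≤ 4 → NN g ≤ ((∑ k, d k) ^ 2) ^ k * NN d := by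
  have hM : 200 ≤ ∑ k, d k := hd.2.2
  induction k with
  | zero =>
    intro g hg _
    have : g = d := by
      ext k
      have := dist1_ge' g d k
      have h0 : |g k - d k| ≤ 0 := by push_cast at hg; linarith
      have := abs_nonpos_iff.1 h0
      linarith
    simp [this]
  | succ k ih =>
    intro g hg hk
    rcases Finset.eq_empty_or_nonempty (Om g) with he | ⟨G, hG⟩
    · have : NN g = 0 := by simp [NN, he]
      rw [this]
      exact mul_nonneg (by positivity) (NN_nonneg d)
    obtain ⟨G', hG'⟩ := hne
    rw [mem_Om] at hG hG'
    have hp1 := dg_even G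
    have hp2 := dg_even G'
    rw [hG] at hp1
    rw [hG'] at hp2
    have hg8 : dist1 g d ≤ 8 := by push_cast at hg; omega
    have fin : ∀ f, dist1 f d ≤ 2 * k → 2 * NN g ≤ (∑ k, f k) ^ 2 * NN f →
        NN g ≤ ((∑ k, d k) ^ 2) ^ (k + 1) * NN d := by
      intro f hf h
      have h1 := ih f hf (by omega)
      have h2 := step_sq (∑ k, f k) (∑ k, d k) hM
        ((dist1_ge f d univ).trans (by omega))
      have h3 : (∑ k, f k) ^ 2 * NN f ≤ 2 * (∑ k, d k) ^ 2 * NN f :=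
        mul_le_mul_of_nonneg_right h2 (NN_nonneg f)
      have h4 : (∑ k, d k) ^ 2 * NN f ≤ (∑ k, d k) ^ 2 * (((∑ k, d k) ^ 2) ^ k * NN d) :=
        mul_le_mul_of_nonneg_left h1 (by positivity)
      have h5 : ((∑ k, d k) ^ 2) ^ (k + 1) * NN d
        = (∑ k, d k) ^ 2 * (((∑ k, d k) ^ 2) ^ k * NN d) := by ring
      rw [h5]; linarith
    push_cast at hg
    by_cases hup : ∃ i, d i < g i
    · obtain ⟨i, hi⟩ := hup
      have e1 := dist1_sub g d i hi
      by_cases hdn : ∃ j, g j < d j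
      · obtain ⟨j, hj⟩ := hdn
        refine fin _ ?_ (type_c d g hd hg8 i j hi)
        have hij : j ≠ i := by rintro rfl; omega
        have e2 := dist1_add (g - ee i) d j (by simp [ee, hij, hj])
        omega
      · push Not at hdn
        have : ∃ j, d j < (g - ee i) j := by
          by_contra hc
          push Not at hc
          have : g - ee i = d := by
            ext j
            apply le_antisymm (hc j)
            simp only [Pi.sub_apply, ee]
            split_ifs with hj
            · subst hj; omega
            · simpa using hdn j
          have h6 : ∑ k, g k - 1 = ∑ k, d k := by
            rw [← sum_ee i, ← Finset.sum_sub_distrib, ← this]; rfl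
          rw [Int.even_iff] at hp1 hp2
          omega
        obtain ⟨j, hj⟩ := this
        refine fin _ ?_ (type_a d g hd hg8 i j hi hj)
        have e2 := dist1_sub (g - ee i) d j hj
        omega
    · push Not at hup
      by_cases heq : ∃ i, g i < d i
      · obtain ⟨i, hi⟩ := heq
        have e1 := dist1_add g d i hi
        have : ∃ j, (g + ee i) j < d j := by
          by_contra hc
          push Not at hc
          have : g + ee i = d := by
            ext j
            refine le_antisymm ?_ (hc j)
            simp only [Pi.add_apply, ee]
            split_ifs with hj
            · subst hj; omega
            · simpa using hup j
          have h6 : ∑ k, g k + 1 = ∑ k, d k := by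
            rw [← sum_ee i, ← Finset.sum_add_distrib, ← this]; rfl
          rw [Int.even_iff] at hp1 hp2
          omega
        obtain ⟨j, hj⟩ := this
        refine fin _ ?_ (type_b d g hd hg8 i j)
        have e2 := dist1_add (g + ee i) d j hj
        omega
      · push Not at heq
        have : g = d := by
          ext k; exact le_antisymm (hup k) (heq k)
        rw [this]
        have h1 : (1:ℤ) ≤ ((∑ k, d k) ^ 2) ^ (k + 1) := by
          apply one_le_pow₀
          nlinarith
        nlinarith [NN_nonneg d]

lemma Fterm_summable (γ : ℝ) (hγ : 2 < γ) : Summable (fun ℓ : ℕ => ((ℓ : ℝ) + 1) * (ℓ : ℝ) ^ (-γ)) := by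
  have h1 : Summable (fun ℓ : ℕ => (ℓ : ℝ) ^ (-γ)) := Real.summable_nat_rpow.2 (by linarith)
  have h2 : Summable (fun ℓ : ℕ => (ℓ : ℝ) ^ (1 - γ)) := Real.summable_nat_rpow.2 (by linarith)
  refine (h2.add h1).congr (fun ℓ => ?_)
  rcases Nat.eq_zero_or_pos ℓ with rfl | h
  · have e1 : (0:ℝ) ^ (-γ) = 0 := Real.zero_rpow (by linarith)
    have e2 : (0:ℝ) ^ (1 - γ) = 0 := Real.zero_rpow (by linarith)
    simp [e1, e2]
  · have hp : (0:ℝ) < ℓ := by exact_mod_cast h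
    rw [sub_eq_add_neg, Real.rpow_add hp, Real.rpow_one]; ring

lemma Fpow_nonneg (γ : ℝ) (i : ℕ) : 0 ≤ Fpow γ i := by
  unfold Fpow
  apply tsum_nonneg
  intro ℓ
  split_ifs <;> positivity

lemma Fpow_summable (γ : ℝ) (hγ : 2 < γ) : Summable (Fpow γ) := by
  have h1 : Summable (fun ℓ : ℕ => (ℓ : ℝ) ^ (-γ)) := Real.summable_nat_rpow.2 (by linarith)
  have hi : ∀ i : ℕ, Summable (fun ℓ : ℕ => if i ≤ ℓ then (ℓ : ℝ) ^ (-γ) else 0) := by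
    intro i
    refine Summable.of_nonneg_of_le (fun ℓ => ?_) (fun ℓ => ?_) h1
    · split_ifs <;> positivity
    · split_ifs
      · exact le_rfl
      · positivity
  refine summable_of_sum_range_le (c := ∑' ℓ : ℕ, ((ℓ : ℝ) + 1) * (ℓ : ℝ) ^ (-γ))
    (Fpow_nonneg γ) (fun m => ?_)
  unfold Fpow
  rw [← Summable.tsum_finsetSum (fun i _ => hi i)]
  refine Summable.tsum_le_tsum (fun ℓ => ?_) (summable_sum (fun i _ => hi i))
    (Fterm_summable γ hγ)
  rw [← Finset.sum_filter, Finset.sum_const, nsmul_eq_mul]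
  apply mul_le_mul_of_nonneg_right _ (by positivity)
  have : ((range m).filter (fun i => i ≤ ℓ)).card ≤ ℓ + 1 := by
    calc _ ≤ (range (ℓ + 1)).card := by
          apply Finset.card_le_card
          intro i
          simp only [Finset.mem_filter, Finset.mem_range]
          omega
      _ = ℓ + 1 := by simp
  exact_mod_cast this

lemma excess_bound (C γ : ℝ) (hC : 0 < C) (hγ : 2 < γ) (ε : ℝ) (hε : 0 < ε) :
    ∃ K : ℕ, ∀ n : ℕ, ∀ d : Fin n → ℕ,
      (∀ i : ℕ, 1 ≤ i →
        (({j : Fin n | i ≤ d j} : Set (Fin n)).ncard : ℝ) ≤ C * n * Fpow γ i) →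
      ((∑ j, (d j - K) : ℕ) : ℝ) ≤ ε * n := by
  have ht := tendsto_sum_nat_add (Fpow γ)
  have hev := ht.eventually (gt_mem_nhds (show (0:ℝ) < ε / C by positivity))
  obtain ⟨K, hK⟩ := hev.exists_forall_of_atTop
  refine ⟨K, fun n d hd => ?_⟩
  have hK1 := hK (K + 1) (by omega)
  set m := univ.sup d with hm
  have h1 : ∀ j, d j - K = ∑ i ∈ range m, if i + (K + 1) ≤ d j then 1 else 0 := by
    intro j
    rw [← Finset.card_filter]
    have hj : d j ≤ m := Finset.le_sup (Finset.mem_univ j)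
    have : (range m).filter (fun i => i + (K + 1) ≤ d j) = range (d j - K) := by
      ext i
      simp only [Finset.mem_filter, Finset.mem_range]
      omega
    rw [this, Finset.card_range]
  have h2 : ∑ j, (d j - K) = ∑ i ∈ range m, ({j : Fin n | i + (K + 1) ≤ d j} : Set (Fin n)).ncard := by
    rw [Finset.sum_congr rfl (fun j _ => h1 j), Finset.sum_comm]
    apply Finset.sum_congr rfl
    intro i _
    rw [← Finset.card_filter, ← Set.ncard_coe_finset]
    congr 1
    ext j
    simp
  rw [h2]
  push_cast
  have hs : Summable (fun i => Fpow γ (i + (K + 1))) :=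
    (summable_nat_add_iff (K + 1)).2 (Fpow_summable γ hγ)
  calc _ ≤ ∑ i ∈ range m, C * n * Fpow γ (i + (K + 1)) :=
        Finset.sum_le_sum (fun i _ => hd _ (by omega))
    _ = C * n * ∑ i ∈ range m, Fpow γ (i + (K + 1)) := by rw [Finset.mul_sum]
    _ ≤ C * n * (ε / C) := by
        apply mul_le_mul_of_nonneg_left _ (by positivity)
        exact (hs.sum_le_tsum _ (fun i _ => Fpow_nonneg γ _)).trans hK1.le
    _ = ε * n := by field_simp

lemma small_of_large (C γ : ℝ) (hC : 0 < C) (hγ : 2 < γ) :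
    ∃ N : ℕ, ∀ n : ℕ, N ≤ n → ∀ d : Fin n → ℕ, (∀ j, 1 ≤ d j) →
      (∀ i : ℕ, 1 ≤ i →
        (({j : Fin n | i ≤ d j} : Set (Fin n)).ncard : ℝ) ≤ C * n * Fpow γ i) →
      SmallD (fun i => (d i : ℤ)) := by
  obtain ⟨K, hK⟩ := excess_bound C γ hC hγ (1 / 16) (by norm_num)
  obtain ⟨L, hL⟩ := excess_bound C γ hC hγ (1 / (16 * (K + 1))) (by positivity)
  refine ⟨16 * (K * (L + 13) + 200), fun n hn d h1 hd => ?_⟩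
  have hKn : 16 * ∑ j, (d j - K) ≤ n := by
    have := hK n d hd
    have h : (16:ℝ) * ((∑ j, (d j - K) : ℕ) : ℝ) ≤ n := by linarith
    exact_mod_cast h
  have hLn : 16 * ((K + 1) * ∑ j, (d j - L)) ≤ n := by
    have := hL n d hd
    have h : (16:ℝ) * ((K + 1) * ((∑ j, (d j - L) : ℕ) : ℝ)) ≤ n := by
      calc _ ≤ (16:ℝ) * ((K + 1) * (1 / (16 * (K + 1)) * n)) := by gcongr
        _ = n := by field_simp
    exact_mod_cast h
  have hM : n ≤ ∑ j, d j := by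
    calc n = ∑ j : Fin n, 1 := by simp
      _ ≤ _ := Finset.sum_le_sum (fun j _ => h1 j)
  refine ⟨?_, fun k => by beta_reduce; exact_mod_cast h1 k, ?_⟩
  · rintro S ⟨z, hz⟩
    beta_reduce at hz ⊢
    have hz' : S.card ≤ d z + 13 := by exact_mod_cast hz
    have hz2 : d z ≤ L + ∑ j, (d j - L) := by
      have := Finset.single_le_sum (f := fun j => d j - L) (fun _ _ => Nat.zero_le _)
        (Finset.mem_univ z)
      omega
    have hS : ∑ s ∈ S, d s ≤ S.card * K + ∑ j, (d j - K) := by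
      calc ∑ s ∈ S, d s ≤ ∑ s ∈ S, (K + (d s - K)) :=
            Finset.sum_le_sum (fun s _ => by omega)
        _ = S.card * K + ∑ s ∈ S, (d s - K) := by
            rw [Finset.sum_add_distrib, Finset.sum_const, smul_eq_mul]
        _ ≤ _ := by
            gcongr
            exact Finset.subset_univ S
    have hSK : S.card * K ≤ K * (L + 13) + (K + 1) * ∑ j, (d j - L) := by
      have h6 : S.card * K ≤ (L + ∑ j, (d j - L) + 13) * K :=
        Nat.mul_le_mul_right K (by omega)
      have h7 : (L + ∑ j, (d j - L) + 13) * K + ∑ j, (d j - L)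
        = K * (L + 13) + (K + 1) * ∑ j, (d j - L) := by ring
      omega
    have : 4 * ∑ s ∈ S, d s + 200 ≤ ∑ k, d k := by omega
    exact_mod_cast this
  · beta_reduce
    have : 200 ≤ ∑ k, d k := by omega
    exact_mod_cast this

/-- Theorem 5.3: nontrivial power-law distribution-bounded
degree sequences with parameter `γ > 2` are `(8,8)`-stable for all large `n`. -/
theorem stmt_11 (C γ : ℝ) (hC : 0 < C) (hγ : 2 < γ) :
    ∃ N : ℕ, ∀ n : ℕ, N ≤ n → ∀ d : Fin n → ℕ, Graphical d → (∀ j, 1 ≤ d j) →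
      (∀ i : ℕ, 1 ≤ i →
        (({j : Fin n | i ≤ d j} : Set (Fin n)).ncard : ℝ) ≤ C * n * Fpow γ i) →
      Stable 8 8 d := by
  obtain ⟨N, hN⟩ := small_of_large C γ hC hγ
  refine ⟨N, fun n hn d hg h1 hd d' _ hdist => ?_⟩
  have hS := hN n hn d h1 hd
  obtain ⟨G, hG⟩ := hg
  have hne : (Om (fun i => (d i : ℤ))).Nonempty := by
    refine ⟨G, (mem_Om _ _).2 ?_⟩
    ext k
    rw [← degOf_eq, hG k]
  have h2 := main_ind _ hS hne 4 (fun i => (d' i : ℤ)) (by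
    unfold dist1
    unfold l1dist at hdist
    have h3 : ((∑ i, ((d' i : ℤ) - (d i : ℤ)).natAbs : ℕ) : ℤ) ≤ 8 := by exact_mod_cast hdist
    push_cast at h3
    simpa using h3) le_rfl
  rw [← Omega_ncard, ← Omega_ncard, ← pow_mul] at h2
  have h4 : ((Omega d').ncard : ℝ) ≤ (Mdeg d : ℝ) ^ 8 * ((Omega d).ncard : ℝ) := by
    unfold Mdeg
    exact_mod_cast h2
  have h5 : (Mdeg d : ℝ) ^ (8:ℝ) = (Mdeg d : ℝ) ^ 8 := by
    exact_mod_cast Real.rpow_natCast (Mdeg d : ℝ) 8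
  rw [h5]
  exact h4
end

section
/- Fix real numbers C > 0, α ≥ 0, β ≥ 0 and γ such that either (a) 1 < γ ≤ 2 and α + 2β/γ < 1, or (b) γ > 2 and α + β < 1. Then there exists N such that for every n ≥ N the following holds: if d is a graphical degree sequence of length n such that every entry d_j satisfies 1 ≤ d_j and (d_j ≤ C or d_j ≥ n^α), and for every integer i ≥ 1 the number of indices j with i·n^α ≤ d_j < (i+1)·n^α is at most C·n^β·i^{−γ}, then d is (8,8)-stable. -/
open Finset

open Classical in
theorem degOf_eq_sum {n : ℕ} (G : SimpleGraph (Fin n)) (i : Fin n) :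
    degOf G i = ∑ j, if G.Adj i j then 1 else 0 := by
  unfold degOf
  rw [← Finset.card_filter, ← Set.ncard_coe_finset]
  congr 1
  ext j
  simp

theorem degOf_add {n : ℕ} (G : SimpleGraph (Fin n)) (u v : Fin n) (huv : u ≠ v)
    (h : ¬ G.Adj u v) (i : Fin n) :
    degOf (G ⊔ SimpleGraph.edge u v) i =
      degOf G i + (if i = u then 1 else 0) + (if i = v then 1 else 0) := by
  classical
  rw [degOf_eq_sum, degOf_eq_sum]
  have h1 : (if i = u then 1 else 0) = ∑ j : Fin n, if (i = u ∧ j = v) then 1 else 0 := by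
    by_cases hi : i = u <;> simp [hi]
  have h2 : (if i = v then 1 else 0) = ∑ j : Fin n, if (i = v ∧ j = u) then 1 else 0 := by
    by_cases hi : i = v <;> simp [hi]
  rw [h1, h2, ← Finset.sum_add_distrib, ← Finset.sum_add_distrib]
  apply Finset.sum_congr rfl
  intro j _
  have h' : ¬ G.Adj v u := fun h2 => h h2.symm
  simp only [SimpleGraph.sup_adj, SimpleGraph.edge_adj]
  by_cases c1 : i = u ∧ j = v
  · obtain ⟨rfl, rfl⟩ := c1
    simp [h, huv]
  · by_cases c2 : i = v ∧ j = u
    · obtain ⟨rfl, rfl⟩ := c2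
      simp [h', huv.symm]
    · simp [c1, c2]

theorem sdiff_edge_sup {n : ℕ} (G : SimpleGraph (Fin n)) (u v : Fin n) (h : G.Adj u v) :
    (G \ SimpleGraph.edge u v) ⊔ SimpleGraph.edge u v = G := by
  apply sdiff_sup_cancel
  rw [SimpleGraph.edge_le_iff]
  exact Or.inr h

theorem not_adj_sdiff {n : ℕ} (G : SimpleGraph (Fin n)) (u v : Fin n) (huv : u ≠ v) :
    ¬ (G \ SimpleGraph.edge u v).Adj u v := by
  simp [SimpleGraph.sdiff_adj, SimpleGraph.edge_adj, huv]

theorem degOf_del {n : ℕ} (G : SimpleGraph (Fin n)) (u v : Fin n)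
    (h : G.Adj u v) (i : Fin n) :
    degOf (G \ SimpleGraph.edge u v) i + (if i = u then 1 else 0) + (if i = v then 1 else 0)
      = degOf G i := by
  rw [← degOf_add _ u v h.ne (not_adj_sdiff G u v h.ne), sdiff_edge_sup G u v h]

theorem sup_edge_inj {n : ℕ} (G G' : SimpleGraph (Fin n)) (u v : Fin n)
    (h : ¬ G.Adj u v) (h' : ¬ G'.Adj u v)
    (e : G ⊔ SimpleGraph.edge u v = G' ⊔ SimpleGraph.edge u v) : G = G' := by
  have d1 : Disjoint (SimpleGraph.edge u v) G := by
    rw [disjoint_comm, SimpleGraph.disjoint_edge]; exact h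
  have d2 : Disjoint (SimpleGraph.edge u v) G' := by
    rw [disjoint_comm, SimpleGraph.disjoint_edge]; exact h'
  have := congrArg (· \ SimpleGraph.edge u v) e
  simpa [sup_sdiff_right_self, d1.sdiff_eq_right, d2.sdiff_eq_right] using this

/-- remove edges at `a` -/
theorem lemA {n : ℕ} (d : Fin n → ℕ) (a : Fin n) (ha : 1 ≤ d a) (W : Fin n → ℕ)
    (hW : ∀ x, x ≠ a → 1 ≤ d x →
      (Omega (fun j => d j - (if j = a then 1 else 0) - (if j = x then 1 else 0))).ncard ≤ W x) :
    (Omega d).ncard ≤ ∑ x, W x := by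
  classical
  have hcov : Omega d ⊆ ⋃ x ∈ (Finset.univ : Finset (Fin n)), {G | G ∈ Omega d ∧ G.Adj a x} := by
    intro G hG
    have h1 : (G.neighborSet a).ncard ≠ 0 := by
      have := hG a
      unfold degOf at this
      omega
    obtain ⟨x, hx⟩ := Set.nonempty_of_ncard_ne_zero h1
    simp only [Set.mem_iUnion]
    exact ⟨x, Finset.mem_univ _, hG, hx⟩
  refine (Set.ncard_le_ncard hcov (Set.toFinite _)).trans ?_
  refine (Finset.set_ncard_biUnion_le _ _).trans ?_
  apply Finset.sum_le_sum
  intro x _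
  by_cases hne : {G | G ∈ Omega d ∧ G.Adj a x}.Nonempty
  · obtain ⟨G0, hG0, hadj⟩ := hne
    have hdx : 1 ≤ d x := by
      have := degOf_del G0 a x hadj x
      rw [hG0 x] at this
      simp at this
      omega
    refine le_trans ?_ (hW x hadj.ne' hdx)
    apply Set.ncard_le_ncard_of_injOn (fun G => G \ SimpleGraph.edge a x)
    · rintro G ⟨hG, hGa⟩ i
      have := degOf_del G a x hGa i
      rw [hG i] at this
      simp only
      omega
    · rintro G ⟨hG, hGa⟩ G' ⟨hG', hGa'⟩ e
      simp only at e
      rw [← sdiff_edge_sup G a x hGa, e, sdiff_edge_sup G' a x hGa']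
  · rw [Set.not_nonempty_iff_eq_empty] at hne
    rw [hne]; simp

theorem lemB {n : ℕ} (d v : Fin n → ℕ) (a b : Fin n)
    (hv : ∀ j, v j = d j + (if j = a then 1 else 0) + (if j = b then 1 else 0))
    (hex : ∀ G ∈ Omega d, ∃ y z, G.Adj y z ∧ y ≠ a ∧ ¬ G.Adj a y ∧ z ≠ b ∧ ¬ G.Adj b z) :
    (Omega d).ncard ≤ v a * v b * (Omega v).ncard := by
  classical
  set P := (Finset.univ : Finset (Fin n × Fin n)) with hP
  have hcov : Omega d ⊆ ⋃ p ∈ P, {G | G ∈ Omega d ∧ G.Adj p.1 p.2 ∧ p.1 ≠ a ∧ ¬ G.Adj a p.1 ∧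
      p.2 ≠ b ∧ ¬ G.Adj b p.2} := by
    intro G hG
    obtain ⟨y, z, h⟩ := hex G hG
    simp only [Set.mem_iUnion]
    exact ⟨(y, z), Finset.mem_univ _, hG, h⟩
  refine (Set.ncard_le_ncard hcov (Set.toFinite _)).trans ?_
  refine (Finset.set_ncard_biUnion_le _ _).trans ?_
  have hstep : ∀ p ∈ P, {G | G ∈ Omega d ∧ G.Adj p.1 p.2 ∧ p.1 ≠ a ∧ ¬ G.Adj a p.1 ∧
      p.2 ≠ b ∧ ¬ G.Adj b p.2}.ncard ≤ ∑ H ∈ (Omega v).toFinset,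
        (if H.Adj a p.1 then 1 else 0) * (if H.Adj b p.2 then 1 else 0) := by
    rintro ⟨y, z⟩ _
    have : ∑ H ∈ (Omega v).toFinset, (if H.Adj a y then 1 else 0) * (if H.Adj b z then 1 else 0)
        = {H | H ∈ Omega v ∧ H.Adj a y ∧ H.Adj b z}.ncard := by
      have e : {H | H ∈ Omega v ∧ H.Adj a y ∧ H.Adj b z} =
        (((Omega v).toFinset.filter (fun H => H.Adj a y ∧ H.Adj b z) : Finset _) : Set _) := by
        ext H; simp
      rw [e, Set.ncard_coe_finset, Finset.card_filter]
      apply Finset.sum_congr rfl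
      intro H _
      by_cases h1 : H.Adj a y <;> by_cases h2 : H.Adj b z <;> simp [h1, h2]
    simp only
    rw [this]
    have key : ∀ G : SimpleGraph (Fin n), G.Adj y z → ¬ G.Adj a y → ¬ G.Adj b z → 
        ¬ (G \ SimpleGraph.edge y z).Adj a y ∧
        ¬ (G \ SimpleGraph.edge y z ⊔ SimpleGraph.edge a y).Adj b z := by
      intro G h1 h2 h3
      constructor
      · simp [h2]
      · simp only [SimpleGraph.sup_adj, SimpleGraph.sdiff_adj, SimpleGraph.edge_adj, h3]
        rintro (h | ⟨⟨rfl, rfl⟩ | ⟨rfl, rfl⟩, h⟩)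
        · exact h.1
        · exact h1.ne rfl
        · exact h2 h1.symm
    apply Set.ncard_le_ncard_of_injOn (fun G => (G \ SimpleGraph.edge y z ⊔ SimpleGraph.edge a y)
      ⊔ SimpleGraph.edge b z)
    · rintro G ⟨hG, h1, h2, h3, h4, h5⟩
      obtain ⟨k1, k2⟩ := key G h1 h3 h5
      refine ⟨?_, ?_, ?_⟩
      · intro i
        have e1 := degOf_del G y z h1 i
        have e2 := degOf_add _ a y h2.symm k1 i
        have e3 := degOf_add _ b z h4.symm k2 i
        rw [hG i] at e1
        rw [hv i, e3, e2]
        omega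
      · simp [SimpleGraph.edge_adj, h2.symm]
      · simp [SimpleGraph.edge_adj, h4.symm]
    · rintro G ⟨hG, h1, h2, h3, h4, h5⟩ G' ⟨hG', h1', h2', h3', h4', h5'⟩ e
      simp only at h1 h2 h3 h4 h5 h1' h2' h3' h4' h5' e
      obtain ⟨k1, k2⟩ := key G h1 h3 h5
      obtain ⟨k1', k2'⟩ := key G' h1' h3' h5'
      have e1 := sup_edge_inj _ _ _ _ k1 k1' (sup_edge_inj _ _ _ _ k2 k2' e)
      rw [← sdiff_edge_sup G y z h1, e1, sdiff_edge_sup G' y z h1']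
  refine (Finset.sum_le_sum hstep).trans ?_
  rw [Finset.sum_comm]
  have : ∀ H ∈ (Omega v).toFinset, ∑ p ∈ P,
      (if H.Adj a p.1 then 1 else 0) * (if H.Adj b p.2 then 1 else 0) = v a * v b := by
    intro H hH
    rw [Set.mem_toFinset] at hH
    rw [← hH a, ← hH b, degOf_eq_sum, degOf_eq_sum, Finset.sum_mul_sum, hP,
      Fintype.sum_prod_type]
  rw [Finset.sum_congr rfl this, Finset.sum_const, smul_eq_mul, mul_comm,
    Set.ncard_eq_toFinset_card']

theorem Mdeg_even {n : ℕ} (d : Fin n → ℕ) (h : Graphical d) : Even (Mdeg d) := by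
  classical
  obtain ⟨G, hG⟩ := h
  have := G.sum_degrees_eq_twice_card_edges
  have e : Mdeg d = ∑ v, G.degree v := by
    apply Finset.sum_congr rfl
    intro i _
    rw [← hG i, degOf, ← SimpleGraph.card_neighborSet_eq_degree, Set.ncard_eq_toFinset_card',
      Set.toFinset_card]
  rw [e, this]
  exact even_two_mul _

/-- the sets of pairs are found by counting -/
theorem exists_pair {n : ℕ} (d : Fin n → ℕ) (G : SimpleGraph (Fin n)) (hG : G ∈ Omega d)
    (a b : Fin n) (B : ℕ)
    (hB : ∀ c : Fin n, ∀ S : Finset (Fin n), S.card ≤ d c + 1 → ∑ y ∈ S, d y ≤ B)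
    (hM : 2 * B < Mdeg d) :
    ∃ y z, G.Adj y z ∧ y ≠ a ∧ ¬ G.Adj a y ∧ z ≠ b ∧ ¬ G.Adj b z := by
  classical
  by_contra hcon
  push Not at hcon
  let S : Fin n → Finset (Fin n) := fun c => insert c (Finset.univ.filter (fun y => G.Adj c y))
  have hS : ∀ c, ∑ y ∈ S c, d y ≤ B := by
    intro c
    apply hB c
    refine (Finset.card_insert_le _ _).trans ?_
    rw [← hG c, degOf_eq_sum, Finset.card_filter]
  have hbound : Mdeg d ≤ ∑ y ∈ S a, d y + ∑ z ∈ S b, d z := by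
    have e0 : Mdeg d = ∑ y, ∑ z, if G.Adj y z then 1 else 0 := by
      apply Finset.sum_congr rfl
      intro i _
      rw [← hG i, degOf_eq_sum]
    have e1 : ∀ c, ∑ y ∈ S c, d y = ∑ y, ∑ z, if y ∈ S c ∧ G.Adj y z then 1 else 0 := by
      intro c
      rw [← Finset.sum_subset (Finset.subset_univ (S c))]
      · apply Finset.sum_congr rfl
        intro y hy
        rw [← hG y, degOf_eq_sum]
        simp [hy]
      · intro y _ hy
        simp [hy]
    have e2 : ∑ z ∈ S b, d z = ∑ y, ∑ z, if z ∈ S b ∧ G.Adj y z then 1 else 0 := by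
      rw [e1, Finset.sum_comm]
      simp only [SimpleGraph.adj_comm]
    rw [e0, e1, e2, ← Finset.sum_add_distrib]
    apply Finset.sum_le_sum
    intro y _
    rw [← Finset.sum_add_distrib]
    apply Finset.sum_le_sum
    intro z _
    by_cases hyz : G.Adj y z
    · by_cases hy : y ∈ S a
      · simp [hyz, hy]
      · have hz : z ∈ S b := by
          simp only [S, Finset.mem_insert, Finset.mem_filter, Finset.mem_univ, true_and,
            not_or] at hy ⊢
          by_cases hzb : z = b
          · exact Or.inl hzb
          · exact Or.inr (hcon y z hyz hy.1 hy.2 hzb)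
        simp [hyz, hz]
    · simp [hyz]
  have := hS a
  have := hS b
  omega

/-- deficiency-only case -/
theorem defic {n : ℕ} (d : Fin n → ℕ) (hd : Graphical d) (B : ℕ)
    (hB : ∀ c : Fin n, ∀ S : Finset (Fin n), S.card ≤ d c + 1 → ∑ y ∈ S, d y ≤ B)
    (hM : 2 * B + 8 < Mdeg d) :
    ∀ q : ℕ, ∀ d' : Fin n → ℕ, (∀ j, d' j ≤ d j) → ∑ j, (d j - d' j) ≤ q → q ≤ 8 → 
      (Omega d').ncard ≤ (∏ j, d j ^ (d j - d' j)) * (Omega d).ncard := by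
  classical
  intro q
  induction q using Nat.strong_induction_on with
  | _ q ih =>
  intro d' hle hq hq8
  by_cases hgr : Graphical d'
  swap
  · rw [Graphical, Set.not_nonempty_iff_eq_empty] at hgr
    rw [hgr]; simp
  have hsum : Mdeg d' + ∑ j, (d j - d' j) = Mdeg d := by
    unfold Mdeg
    rw [← Finset.sum_add_distrib]
    apply Finset.sum_congr rfl
    intro j _
    have := hle j
    omega
  have hev := Mdeg_even d hd
  have hev' := Mdeg_even d' hgr
  by_cases h0 : ∀ j, d j - d' j = 0
  · have : d' = d := by
      funext j
      have := h0 j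
      have := hle j
      omega
    subst this
    simp
  push Not at h0
  obtain ⟨a, ha⟩ := h0
  let u : Fin n → ℕ := fun j => d' j + (if j = a then 1 else 0)
  have hu : ∑ j, (d j - d' j) = ∑ j, (d j - u j) + 1 := by
    have : (1:ℕ) = ∑ j : Fin n, (if j = a then 1 else 0) := by simp
    rw [this, ← Finset.sum_add_distrib]
    apply Finset.sum_congr rfl
    intro j _
    simp only [u]
    by_cases hj : j = a
    · subst hj; simp; omega
    · simp [hj]
  have hb : ∃ b, d b - u b ≠ 0 := by
    by_contra hcon
    push Not at hcon
    rw [Finset.sum_eq_zero (fun j _ => hcon j)] at hu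
    rw [hu] at hsum
    rw [← hsum] at hev
    rcases hev with ⟨r, hr⟩
    rcases hev' with ⟨s, hs⟩
    omega
  obtain ⟨b, hb⟩ := hb
  let v : Fin n → ℕ := fun j => u j + (if j = b then 1 else 0)
  have hvu : ∑ j, (d j - u j) = ∑ j, (d j - v j) + 1 := by
    have : (1:ℕ) = ∑ j : Fin n, (if j = b then 1 else 0) := by simp
    rw [this, ← Finset.sum_add_distrib]
    apply Finset.sum_congr rfl
    intro j _
    simp only [v]
    by_cases hj : j = b
    · subst hj; simp; omega
    · simp [hj]
  have hul : ∀ j, u j ≤ d j := by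
    intro j
    simp only [u]
    by_cases hj : j = a
    · subst hj; simp; omega
    · simp [hj, hle]
  have hvl : ∀ j, v j ≤ d j := by
    intro j
    simp only [v]
    by_cases hj : j = b
    · subst hj; simp; omega
    · simp [hj, hul]
  have h1 := lemB d' v a b (fun j => rfl) (by
    intro G hG
    apply exists_pair d' G hG a b B
    · intro c S hS
      refine le_trans (Finset.sum_le_sum (fun j _ => hle j)) (hB c S ?_)
      have := hle c
      omega
    · omega)
  have h2 := ih (q - 2) (by omega) v hvl (by omega) (by omega)
  have hp1 : ∏ j, d j ^ (d j - d' j) = (∏ j, d j ^ (d j - u j)) * d a := by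
    have : d a = ∏ j : Fin n, (if j = a then d j else 1) := by simp
    rw [this, ← Finset.prod_mul_distrib]
    apply Finset.prod_congr rfl
    intro j _
    simp only [u]
    by_cases hj : j = a
    · subst hj
      simp only [if_true]
      rw [← pow_succ]
      congr 1
      omega
    · simp [hj]
  have hp2 : ∏ j, d j ^ (d j - u j) = (∏ j, d j ^ (d j - v j)) * d b := by
    have : d b = ∏ j : Fin n, (if j = b then d j else 1) := by simp
    rw [this, ← Finset.prod_mul_distrib]
    apply Finset.prod_congr rfl
    intro j _
    simp only [v]
    by_cases hj : j = b
    · subst hj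
      simp only [if_true]
      rw [← pow_succ]
      congr 1
      omega
    · simp [hj]
  calc (Omega d').ncard ≤ v a * v b * (Omega v).ncard := h1
    _ ≤ d a * d b * ((∏ j, d j ^ (d j - v j)) * (Omega d).ncard) := by
      gcongr
      · exact hvl a
      · exact hvl b
    _ = _ := by rw [hp1, hp2]; ring

theorem excess {n : ℕ} (d : Fin n → ℕ) (hd : Graphical d) (hd1 : ∀ j, 1 ≤ d j) (B : ℕ)
    (hB : ∀ c : Fin n, ∀ S : Finset (Fin n), S.card ≤ d c + 1 → ∑ y ∈ S, d y ≤ B)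
    (hM : 2 * B + 8 < Mdeg d) :
    ∀ p : ℕ, ∀ d' : Fin n → ℕ, ∑ j, (d' j - d j) ≤ p → p + ∑ j, (d j - d' j) ≤ 8 → 
      (Omega d').ncard ≤ Mdeg d ^ p * (∏ j, d j ^ (d j - d' j)) * (Omega d).ncard := by
  classical
  intro p
  induction p with
  | zero =>
    intro d' hp hq
    have hle : ∀ j, d' j ≤ d j := by
      intro j
      have : d' j - d j ≤ ∑ j, (d' j - d j) :=
        Finset.single_le_sum (f := fun j => d' j - d j) (fun _ _ => Nat.zero_le _)
          (Finset.mem_univ j)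
      omega
    have := defic d hd B hB hM (∑ j, (d j - d' j)) d' hle le_rfl (by omega)
    simpa using this
  | succ p ih =>
    intro d' hp hq
    have hM1 : 1 ≤ Mdeg d := by omega
    by_cases hle : ∀ j, d' j ≤ d j
    · have h1 := defic d hd B hB hM (∑ j, (d j - d' j)) d' hle le_rfl (by omega)
      refine h1.trans ?_
      apply Nat.mul_le_mul_right
      exact Nat.le_mul_of_pos_left _ (by positivity)
    push Not at hle
    obtain ⟨a, ha⟩ := hle
    have := lemA d' a (by omega)
      (fun x => Mdeg d ^ p * (d x * ∏ j, d j ^ (d j - d' j)) * (Omega d).ncard) (by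
      intro x hxa hx1
      let w : Fin n → ℕ := fun j => d' j - (if j = a then 1 else 0) - (if j = x then 1 else 0)
      have e1 : ∑ j, (w j - d j) + 1 ≤ ∑ j, (d' j - d j) := by
        have : (1:ℕ) = ∑ j : Fin n, (if j = a then 1 else 0) := by simp
        rw [this, ← Finset.sum_add_distrib]
        apply Finset.sum_le_sum
        intro j _
        simp only [w]
        by_cases hj : j = a
        · subst hj; simp; omega
        · simp [hj]; omega
      have e2 : ∑ j, (d j - w j) ≤ ∑ j, (d j - d' j) + 1 := by
        have : (1:ℕ) = ∑ j : Fin n, (if j = x then 1 else 0) := by simp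
        rw [this, ← Finset.sum_add_distrib]
        apply Finset.sum_le_sum
        intro j _
        simp only [w]
        by_cases hj : j = a
        · subst hj; simp [hxa.symm]; omega
        · simp [hj]; omega
      have e3 : ∏ j, d j ^ (d j - w j) ≤ d x * ∏ j, d j ^ (d j - d' j) := by
        have : d x = ∏ j : Fin n, (if j = x then d j else 1) := by simp
        rw [this, ← Finset.prod_mul_distrib]
        apply Finset.prod_le_prod'
        intro j _
        by_cases hjx : j = x
        · subst hjx
          simp only [if_true]
          rw [← pow_succ']
          apply Nat.pow_le_pow_right (hd1 j)
          simp only [w, hxa, if_false, if_true]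
          omega
        · simp only [hjx, if_false, one_mul]
          apply Nat.pow_le_pow_right (hd1 j)
          simp only [w, hjx, if_false]
          by_cases hj : j = a
          · subst hj; simp; omega
          · simp [hj]
      refine (ih w (by omega) (by omega)).trans ?_
      gcongr)
    refine this.trans ?_
    rw [← Finset.sum_mul, ← Finset.mul_sum, ← Finset.sum_mul]
    apply le_of_eq
    rw [pow_succ, Mdeg]
    ring

theorem stable_of_bound {n : ℕ} (d : Fin n → ℕ) (hd : Graphical d) (hd1 : ∀ j, 1 ≤ d j) (B : ℕ)
    (hB : ∀ c : Fin n, ∀ S : Finset (Fin n), S.card ≤ d c + 1 → ∑ y ∈ S, d y ≤ B)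
    (hM : 2 * B + 8 < Mdeg d) : Stable 8 8 d := by
  intro d' _ hl
  have hs : ∑ j, (d' j - d j) + ∑ j, (d j - d' j) ≤ 8 := by
    refine le_trans (le_of_eq ?_) hl
    rw [l1dist, ← Finset.sum_add_distrib]
    apply Finset.sum_congr rfl
    intro j _
    omega
  have h1 := excess d hd hd1 B hB hM _ d' le_rfl hs
  have h2 : ∏ j, d j ^ (d j - d' j) ≤ Mdeg d ^ (∑ j, (d j - d' j)) := by
    rw [← Finset.prod_pow_eq_pow_sum]
    apply Finset.prod_le_prod'
    intro j _
    apply Nat.pow_le_pow_left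
    exact Finset.single_le_sum (f := d) (fun _ _ => Nat.zero_le _) (Finset.mem_univ j)
  have h3 : (Omega d').ncard ≤ Mdeg d ^ 8 * (Omega d).ncard := by
    refine h1.trans ?_
    apply Nat.mul_le_mul_right
    refine (Nat.mul_le_mul_left _ h2).trans ?_
    rw [← pow_add]
    exact Nat.pow_le_pow_right (by omega) hs
  have e : (Mdeg d : ℝ) ^ (8 : ℝ) = (Mdeg d : ℝ) ^ (8 : ℕ) := by
    rw [← Real.rpow_natCast]; norm_num
  rw [e]
  exact_mod_cast h3

theorem large_sum (C α β γ s : ℝ) (hC : 0 < C) (hs : 1 ≤ s) (hγs : 2 < γ * s)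
    (n : ℕ) (hn : 1 ≤ n) (d : Fin n → ℕ)
    (h1 : ∀ j, 1 ≤ d j ∧ ((d j : ℝ) ≤ C ∨ (n : ℝ) ^ α ≤ (d j : ℝ)))
    (h2 : ∀ i : ℕ, 1 ≤ i →
        (({j : Fin n | (i : ℝ) * (n : ℝ) ^ α ≤ (d j : ℝ) ∧
            (d j : ℝ) < ((i : ℝ) + 1) * (n : ℝ) ^ α} : Set (Fin n)).ncard : ℝ)
          ≤ C * (n : ℝ) ^ β * (i : ℝ) ^ (-γ)) :
    ∑ j ∈ Finset.univ.filter (fun j => C < (d j : ℝ)), (d j : ℝ) ≤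
      (2 * C ^ s * ∑' i : ℕ, (i : ℝ) ^ (1 - γ * s)) * (n : ℝ) ^ (α + β * s) := by
  classical
  have hn0 : (0 : ℝ) < n := by exact_mod_cast hn
  have hna : (0 : ℝ) < (n : ℝ) ^ α := Real.rpow_pos_of_pos hn0 _
  set T := Finset.univ.filter (fun j => C < (d j : ℝ)) with hT
  let f : Fin n → ℕ := fun j => ⌊(d j : ℝ) / (n : ℝ) ^ α⌋₊
  have hf1 : ∀ j ∈ T, 1 ≤ f j := by
    intro j hj
    have hj' : C < (d j : ℝ) := by simpa [hT] using hj
    rcases (h1 j).2 with h | h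
    · linarith
    · apply Nat.le_floor
      rw [le_div_iff₀ hna]
      simpa using h
  have hfl : ∀ j, (f j : ℝ) * (n : ℝ) ^ α ≤ (d j : ℝ) := by
    intro j
    rw [← le_div_iff₀ hna]
    exact Nat.floor_le (by positivity)
  have hfu : ∀ j, (d j : ℝ) < ((f j : ℝ) + 1) * (n : ℝ) ^ α := by
    intro j
    rw [← div_lt_iff₀ hna]
    exact Nat.lt_floor_add_one _
  rw [← Finset.sum_fiberwise_of_maps_to (s := T) (t := T.image f) (g := f)
    (fun j hj => Finset.mem_image_of_mem f hj)]
  have hterm : ∀ i ∈ T.image f, ∑ j ∈ T with f j = i, (d j : ℝ) ≤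
      2 * C ^ s * (n : ℝ) ^ (α + β * s) * (i : ℝ) ^ (1 - γ * s) := by
    intro i hi
    obtain ⟨j0, hj0, hj0i⟩ := Finset.mem_image.mp hi
    have hi1 : 1 ≤ i := hj0i ▸ hf1 j0 hj0
    have hi1' : (1 : ℝ) ≤ i := by exact_mod_cast hi1
    have hi0 : (0 : ℝ) < i := by linarith
    set c := (T.filter (fun j => f j = i)).card with hc
    set X := C * (n : ℝ) ^ β * (i : ℝ) ^ (-γ) with hX
    have hX0 : 0 ≤ X := by positivity
    have hcX : (c : ℝ) ≤ X := by
      refine le_trans ?_ (h2 i hi1)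
      rw [hc, ← Set.ncard_coe_finset]
      rw [Nat.cast_le]
      apply Set.ncard_le_ncard _ (Set.toFinite _)
      intro j hj
      have hji : f j = i := by
        have := Finset.mem_coe.mp hj
        exact (Finset.mem_filter.mp this).2
      refine ⟨?_, ?_⟩
      · have := hfl j
        rw [hji] at this
        exact this
      · have := hfu j
        rw [hji] at this
        exact this
    have hcs : (c : ℝ) ≤ X ^ s := by
      rcases Nat.eq_zero_or_pos c with h | h
      · rw [h]; simp only [Nat.cast_zero]; positivity
      · have h' : (1 : ℝ) ≤ c := by exact_mod_cast h
        exact (Real.self_le_rpow_of_one_le h' hs).trans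
          (Real.rpow_le_rpow (by positivity) hcX (by linarith))
    have hXs : X ^ s = C ^ s * (n : ℝ) ^ (β * s) * (i : ℝ) ^ (-γ * s) := by
      rw [hX, Real.mul_rpow (by positivity) (by positivity), Real.mul_rpow (by positivity)
        (by positivity), ← Real.rpow_mul hn0.le, ← Real.rpow_mul hi0.le]
    calc ∑ j ∈ T with f j = i, (d j : ℝ) ≤ ∑ j ∈ T with f j = i, 2 * (i : ℝ) * (n : ℝ) ^ α := by
          apply Finset.sum_le_sum
          intro j hj
          have hji : f j = i := (Finset.mem_filter.mp hj).2
          have := hfu j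
          rw [hji] at this
          refine this.le.trans ?_
          gcongr
          linarith
      _ = c * (2 * (i : ℝ) * (n : ℝ) ^ α) := by rw [Finset.sum_const, nsmul_eq_mul]
      _ ≤ X ^ s * (2 * (i : ℝ) * (n : ℝ) ^ α) := by gcongr
      _ = _ := by
        rw [hXs, Real.rpow_add hn0, show 1 - γ * s = 1 + -γ * s by ring, Real.rpow_add hi0,
          Real.rpow_one]
        ring
  refine (Finset.sum_le_sum hterm).trans ?_
  rw [← Finset.mul_sum]
  have hsum : Summable (fun i : ℕ => (i : ℝ) ^ (1 - γ * s)) := by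
    rw [Real.summable_nat_rpow]
    linarith
  have := hsum.sum_le_tsum (T.image f) (fun i _ => by positivity)
  calc _ ≤ 2 * C ^ s * (n : ℝ) ^ (α + β * s) * ∑' i : ℕ, (i : ℝ) ^ (1 - γ * s) := by
        gcongr
    _ = _ := by ring

theorem exists_s (α β γ : ℝ) (hβ : 0 ≤ β)
    (hcase : (1 < γ ∧ γ ≤ 2 ∧ α + 2 * β / γ < 1) ∨ (2 < γ ∧ α + β < 1)) :
    ∃ s : ℝ, 1 ≤ s ∧ 2 < γ * s ∧ α + β * s < 1 := by
  rcases hcase with ⟨h1, h2, h3⟩ | ⟨h1, h2⟩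
  · have hg : 0 < γ := by linarith
    set e := (1 - (α + 2 * β / γ)) / (2 * (β + 1)) with he
    have he0 : 0 < e := by
      apply div_pos <;> linarith
    have hee : e * (2 * (β + 1)) = 1 - (α + 2 * β / γ) := by
      rw [he]; field_simp
    refine ⟨2 / γ + e, ?_, ?_, ?_⟩
    · have : 1 ≤ 2 / γ := by rw [le_div_iff₀ hg]; linarith
      linarith
    · have : γ * (2 / γ + e) = 2 + γ * e := by field_simp
      rw [this]
      have := mul_pos hg he0
      linarith
    · have : β * (2 / γ + e) = 2 * β / γ + β * e := by ring
      rw [this]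
      nlinarith [mul_nonneg hβ he0.le]
  · exact ⟨1, le_rfl, by linarith, by linarith⟩

theorem exists_N (C A θ : ℝ) (hθ : θ < 1) :
    ∃ N : ℕ, ∀ n : ℕ, N ≤ n →
      2 * (A * (n : ℝ) ^ θ + C * (C + A * (n : ℝ) ^ θ + 1)) + 8 < n := by
  have t1 : Filter.Tendsto (fun n : ℕ => (n : ℝ) ^ (-(1 - θ))) Filter.atTop (nhds 0) :=
    (tendsto_rpow_neg_atTop (by linarith)).comp tendsto_natCast_atTop_atTop
  have t2 : Filter.Tendsto (fun n : ℕ => ((n : ℝ))⁻¹) Filter.atTop (nhds 0) :=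
    tendsto_inv_atTop_zero.comp tendsto_natCast_atTop_atTop
  have t3 : Filter.Tendsto (fun n : ℕ => (2 * A + 2 * C * A) * (n : ℝ) ^ (-(1 - θ)) +
      (2 * C * (C + 1) + 8) * ((n : ℝ))⁻¹) Filter.atTop (nhds 0) := by
    simpa using (t1.const_mul (2 * A + 2 * C * A)).add (t2.const_mul (2 * C * (C + 1) + 8))
  have t4 := (t3.eventually (gt_mem_nhds (zero_lt_one))).and (Filter.eventually_ge_atTop 1)
  obtain ⟨N, hN⟩ := Filter.eventually_atTop.mp t4
  refine ⟨N, fun n hn => ?_⟩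
  obtain ⟨h, h1⟩ := hN n hn
  have hn0 : (0 : ℝ) < n := by exact_mod_cast h1
  have e : (n : ℝ) ^ θ = (n : ℝ) ^ (-(1 - θ)) * n := by
    nth_rewrite 3 [← Real.rpow_one (n : ℝ)]
    rw [← Real.rpow_add hn0]; ring_nf
  have := mul_lt_mul_of_pos_right h hn0
  rw [add_mul, mul_assoc _ _ (n : ℝ), ← e, mul_assoc _ _ (n : ℝ), inv_mul_cancel₀ hn0.ne'] at this
  linarith

/-- Theorem 5.5: long-tailed power-law degree sequences with
parameters `(α, β, γ)` satisfying (a) or (b) are `(8,8)`-stable for large `n`. -/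
theorem stmt_12 (C α β γ : ℝ) (hC : 0 < C) (hα : 0 ≤ α) (hβ : 0 ≤ β)
    (hcase : (1 < γ ∧ γ ≤ 2 ∧ α + 2 * β / γ < 1) ∨ (2 < γ ∧ α + β < 1)) :
    ∃ N : ℕ, ∀ n : ℕ, N ≤ n → ∀ d : Fin n → ℕ, Graphical d →
      (∀ j, 1 ≤ d j ∧ ((d j : ℝ) ≤ C ∨ (n : ℝ) ^ α ≤ (d j : ℝ))) →
      (∀ i : ℕ, 1 ≤ i →
        (({j : Fin n | (i : ℝ) * (n : ℝ) ^ α ≤ (d j : ℝ) ∧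
            (d j : ℝ) < ((i : ℝ) + 1) * (n : ℝ) ^ α} : Set (Fin n)).ncard : ℝ)
          ≤ C * (n : ℝ) ^ β * (i : ℝ) ^ (-γ)) →
      Stable 8 8 d := by
  obtain ⟨s, hs1, hs2, hs3⟩ := exists_s α β γ hβ hcase
  set A := 2 * C ^ s * ∑' i : ℕ, (i : ℝ) ^ (1 - γ * s) with hA
  obtain ⟨N, hN⟩ := exists_N C A (α + β * s) hs3
  refine ⟨max N 1, fun n hn d hd h1 h2 => ?_⟩
  have hn1 : 1 ≤ n := (le_max_right _ _).trans hn
  have hlt := hN n ((le_max_left _ _).trans hn)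
  have hH := large_sum C α β γ s hC hs1 hs2 n hn1 d h1 h2
  rw [← hA] at hH
  set H := A * (n : ℝ) ^ (α + β * s) with hHd
  have hH0 : 0 ≤ H := le_trans (Finset.sum_nonneg (fun _ _ => by positivity)) hH
  have hdc : ∀ c, (d c : ℝ) ≤ C + H := by
    intro c
    by_cases hc : C < (d c : ℝ)
    · have : (d c : ℝ) ≤ ∑ j ∈ Finset.univ.filter (fun j => C < (d j : ℝ)), (d j : ℝ) :=
        Finset.single_le_sum (f := fun j => (d j : ℝ)) (fun _ _ => by positivity)
          (by simpa using hc)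
      linarith
    · linarith
  apply stable_of_bound d hd (fun j => (h1 j).1) ⌊H + C * (C + H + 1)⌋₊
  · intro c S hS
    apply Nat.le_floor
    push_cast
    rw [← Finset.sum_filter_add_sum_filter_not S (fun j => C < (d j : ℝ))]
    have a1 : ∑ j ∈ S with C < (d j : ℝ), (d j : ℝ) ≤ H := by
      refine le_trans (Finset.sum_le_sum_of_subset_of_nonneg ?_ ?_) hH
      · exact Finset.filter_subset_filter _ (Finset.subset_univ _)
      · intros; positivity
    have a2 : ∑ j ∈ S with ¬ C < (d j : ℝ), (d j : ℝ) ≤ C * (C + H + 1) := by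
      calc _ ≤ ∑ j ∈ S with ¬ C < (d j : ℝ), C := by
            apply Finset.sum_le_sum
            intro j hj
            exact not_lt.mp (Finset.mem_filter.mp hj).2
        _ = ((S.filter (fun j => ¬ C < (d j : ℝ))).card : ℝ) * C := by
            rw [Finset.sum_const, nsmul_eq_mul]
        _ ≤ ((d c : ℝ) + 1) * C := by
            gcongr
            exact_mod_cast (Finset.card_filter_le _ _).trans hS
        _ ≤ C * (C + H + 1) := by
            have := hdc c
            nlinarith
    linarith
  · have b1 : (n : ℝ) ≤ Mdeg d := by
      have : n ≤ Mdeg d := by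
        have := Finset.sum_le_sum (fun j (_ : j ∈ (Finset.univ : Finset (Fin n))) => (h1 j).1)
        simpa [Mdeg] using this
      exact_mod_cast this
    have b2 : (⌊H + C * (C + H + 1)⌋₊ : ℝ) ≤ H + C * (C + H + 1) := by
      apply Nat.floor_le
      positivity
    have : (2 * (⌊H + C * (C + H + 1)⌋₊ : ℝ) + 8) < Mdeg d := by linarith
    exact_mod_cast this
end

section
/- Let (d⁻,d⁺) be a digraphical directed degree sequence of length n with M(d⁻,d⁺) > J⁻(d⁻,d⁺) + J⁺(d⁻,d⁺) + 3·(Δ⁻(d⁻) + Δ⁺(d⁺)) + 3. Then (d⁻,d⁺) is (2,2)-stable; that is, |Ω(d'⁻,d'⁺)| ≤ M(d⁻,d⁺)² · |Ω(d⁻,d⁺)| for every digraphical (d'⁻,d'⁺) with ‖d'⁻ − d⁻‖₁ + ‖d'⁺ − d⁺‖₁ ≤ 2. -/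
open Finset

/-- The in-degree of vertex `i` in the arc set `A`. -/
def inDeg {n : ℕ} (A : Finset (Fin n × Fin n)) (i : Fin n) : ℕ :=
  (A.filter (fun a => a.2 = i)).card

/-- The out-degree of vertex `i` in the arc set `A`. -/
def outDeg {n : ℕ} (A : Finset (Fin n × Fin n)) (i : Fin n) : ℕ :=
  (A.filter (fun a => a.1 = i)).card

/-- `Ω(d⁻,d⁺)`: the set of loopless digraphs (arc sets) on `{1,…,n}` in which
vertex `i` has in-degree `d⁻ i` and out-degree `d⁺ i` for all `i`. -/
def OmegaDir {n : ℕ} (dm dp : Fin n → ℕ) : Set (Finset (Fin n × Fin n)) :=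
  {A | (∀ a ∈ A, a.1 ≠ a.2) ∧ (∀ i, inDeg A i = dm i) ∧ (∀ i, outDeg A i = dp i)}

/-- A directed degree sequence is digraphical if it is realised by a digraph. -/
def DigraphicalDir {n : ℕ} (dm dp : Fin n → ℕ) : Prop := (OmegaDir dm dp).Nonempty

/-- A digraphical `(d⁻,d⁺)` is `(k,α)`-stable if
`|Ω(d'⁻,d'⁺)| ≤ M(d⁻,d⁺)^α |Ω(d⁻,d⁺)|` for every digraphical `(d'⁻,d'⁺)` with
`‖d'⁻ - d⁻‖₁ + ‖d'⁺ - d⁺‖₁ ≤ k`. -/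
def StableDir {n : ℕ} (k : ℕ) (α : ℝ) (dm dp : Fin n → ℕ) : Prop :=
  ∀ dm' dp' : Fin n → ℕ, DigraphicalDir dm' dp' →
    l1dist dm' dm + l1dist dp' dp ≤ k →
    ((OmegaDir dm' dp').ncard : ℝ) ≤ (Mdeg dm : ℝ) ^ α * ((OmegaDir dm dp).ncard : ℝ)


lemma inDeg_insert' {n : ℕ} {A : Finset (Fin n × Fin n)} {a : Fin n × Fin n} (h : a ∉ A)
    (i : Fin n) : inDeg (insert a A) i = inDeg A i + (if i = a.2 then 1 else 0) := by
  unfold inDeg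
  rw [filter_insert]
  by_cases h1 : a.2 = i
  · rw [if_pos h1, if_pos h1.symm, card_insert_of_notMem (by simp [h])]
  · rw [if_neg h1, if_neg (Ne.symm h1)]; rfl

lemma outDeg_insert' {n : ℕ} {A : Finset (Fin n × Fin n)} {a : Fin n × Fin n} (h : a ∉ A)
    (i : Fin n) : outDeg (insert a A) i = outDeg A i + (if i = a.1 then 1 else 0) := by
  unfold outDeg
  rw [filter_insert]
  by_cases h1 : a.1 = i
  · rw [if_pos h1, if_pos h1.symm, card_insert_of_notMem (by simp [h])]
  · rw [if_neg h1, if_neg (Ne.symm h1)]; rfl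

lemma inDeg_erase' {n : ℕ} {A : Finset (Fin n × Fin n)} {a : Fin n × Fin n} (h : a ∈ A)
    (i : Fin n) : inDeg (A.erase a) i + (if i = a.2 then 1 else 0) = inDeg A i := by
  rw [← inDeg_insert' (notMem_erase a A), insert_erase h]

lemma outDeg_erase' {n : ℕ} {A : Finset (Fin n × Fin n)} {a : Fin n × Fin n} (h : a ∈ A)
    (i : Fin n) : outDeg (A.erase a) i + (if i = a.1 then 1 else 0) = outDeg A i := by
  rw [← outDeg_insert' (notMem_erase a A), insert_erase h]

lemma card_filter_in {n : ℕ} (A : Finset (Fin n × Fin n)) (T : Finset (Fin n)) :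
    (A.filter (fun a => a.2 ∈ T)).card = ∑ i ∈ T, inDeg A i := by
  rw [card_eq_sum_card_fiberwise (f := fun a : Fin n × Fin n => a.2) (t := T)]
  · refine sum_congr rfl fun i hi => ?_
    unfold inDeg
    congr 1
    ext a
    simp only [mem_filter]
    constructor
    · rintro ⟨⟨h1, h2⟩, h3⟩; exact ⟨h1, h3⟩
    · rintro ⟨h1, h3⟩; exact ⟨⟨h1, h3 ▸ hi⟩, h3⟩
  · intro a ha
    simpa using (mem_filter.1 ha).2

lemma card_filter_out {n : ℕ} (A : Finset (Fin n × Fin n)) (T : Finset (Fin n)) :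
    (A.filter (fun a => a.1 ∈ T)).card = ∑ i ∈ T, outDeg A i := by
  rw [card_eq_sum_card_fiberwise (f := fun a : Fin n × Fin n => a.1) (t := T)]
  · refine sum_congr rfl fun i hi => ?_
    unfold outDeg
    congr 1
    ext a
    simp only [mem_filter]
    constructor
    · rintro ⟨⟨h1, h2⟩, h3⟩; exact ⟨h1, h3⟩
    · rintro ⟨h1, h3⟩; exact ⟨⟨h1, h3 ▸ hi⟩, h3⟩
  · intro a ha
    simpa using (mem_filter.1 ha).2

lemma card_eq_in {n : ℕ} (A : Finset (Fin n × Fin n)) : A.card = ∑ i, inDeg A i := by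
  rw [← card_filter_in]; simp

def outN {n : ℕ} (A : Finset (Fin n × Fin n)) (x : Fin n) : Finset (Fin n) :=
  (A.filter (fun a => a.1 = x)).image Prod.snd

def inN {n : ℕ} (A : Finset (Fin n × Fin n)) (x : Fin n) : Finset (Fin n) :=
  (A.filter (fun a => a.2 = x)).image Prod.fst

lemma mem_outN {n : ℕ} {A : Finset (Fin n × Fin n)} {x y : Fin n} :
    y ∈ outN A x ↔ (x, y) ∈ A := by
  simp [outN]

lemma mem_inN {n : ℕ} {A : Finset (Fin n × Fin n)} {x y : Fin n} :
    y ∈ inN A x ↔ (y, x) ∈ A := by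
  simp [inN]

lemma card_outN_le {n : ℕ} (A : Finset (Fin n × Fin n)) (x : Fin n) :
    (outN A x).card ≤ outDeg A x := card_image_le

lemma card_inN_le {n : ℕ} (A : Finset (Fin n × Fin n)) (x : Fin n) :
    (inN A x).card ≤ inDeg A x := card_image_le

lemma outDeg_le {n : ℕ} (A : Finset (Fin n × Fin n)) (x : Fin n) : outDeg A x ≤ n := by
  have : outDeg A x = (outN A x).card := by
    unfold outDeg outN
    rw [card_image_of_injOn]
    rintro ⟨a, b⟩ h ⟨c, d⟩ h' e
    simp at h h' e
    simp [h.2, h'.2, e]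
  rw [this]
  simpa using card_le_univ (outN A x)

lemma inDeg_le {n : ℕ} (A : Finset (Fin n × Fin n)) (x : Fin n) : inDeg A x ≤ n := by
  have : inDeg A x = (inN A x).card := by
    unfold inDeg inN
    rw [card_image_of_injOn]
    rintro ⟨a, b⟩ h ⟨c, d⟩ h' e
    simp at h h' e
    simp [h.2, h'.2, e]
  rw [this]
  simpa using card_le_univ (inN A x)

lemma le_Δ {n : ℕ} (d : Fin n → ℕ) (i : Fin n) : d i ≤ Δdeg d :=
  le_sup (f := d) (mem_univ i)

lemma sum_le_sumLargest {n k : ℕ} (d : Fin n → ℕ) (S : Finset (Fin n)) (h1 : S.card ≤ k)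
    (h2 : k ≤ n) : ∑ i ∈ S, d i ≤ sumLargest k d := by
  obtain ⟨T, hST, hT⟩ := exists_superset_card_eq h1 (by simpa using h2)
  calc ∑ i ∈ S, d i ≤ ∑ i ∈ T, d i := sum_le_sum_of_subset hST
    _ ≤ _ := le_sup (f := fun S => ∑ i ∈ S, d i) (by simp [mem_powersetCard, hT])

lemma core {n : ℕ} (dm dp : Fin n → ℕ) (hm : Δdeg dm ≤ n) (hp : Δdeg dp ≤ n)
    (h : Mdeg dm > sumLargest (Δdeg dm) dp + sumLargest (Δdeg dp) dm + 1)
    (F : Finset (Fin n × Fin n)) (x y : Fin n) (hl : ∀ a ∈ F, a.1 ≠ a.2)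
    (hin : ∀ i, inDeg F i + (if i = y then 1 else 0) = dm i)
    (hout : ∀ i, outDeg F i + (if i = x then 1 else 0) = dp i) :
    ∃ H ∈ OmegaDir dm dp, ((x, y) ∈ H ∧ F = H.erase (x, y)) ∨
      ∃ p q, (x, q) ∈ H ∧ (p, y) ∈ H ∧ (x = y ∨ (x, y) ∈ H) ∧
        F = insert (p, q) ((H.erase (x, q)).erase (p, y)) := by
  by_cases hxy : x ≠ y ∧ (x, y) ∉ F
  · obtain ⟨h1, h2⟩ := hxy
    refine ⟨insert (x, y) F, ⟨?_, ?_, ?_⟩, Or.inl ⟨mem_insert_self _ _, ?_⟩⟩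
    · intro a ha
      rcases mem_insert.1 ha with rfl | ha
      · exact h1
      · exact hl a ha
    · intro i; rw [inDeg_insert' h2, ← hin i]
    · intro i; rw [outDeg_insert' h2, ← hout i]
    · rw [erase_insert h2]
  have hcard : F.card + 1 = Mdeg dm := by
    rw [card_eq_in]
    unfold Mdeg
    rw [← sum_congr rfl (fun i _ => hin i), sum_add_distrib]
    simp
  have hb1 : (F.filter (fun a => a.2 ∈ insert x (outN F x))).card ≤ sumLargest (Δdeg dp) dm := by
    rw [card_filter_in]
    refine le_trans (sum_le_sum (g := dm) fun i _ => ?_) (sum_le_sumLargest _ _ ?_ hp)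
    · rw [← hin i]; omega
    · have := card_insert_le x (outN F x)
      have h2 := card_outN_le F x
      have h3 := hout x
      have h4 := le_Δ dp x
      simp at h3; omega
  have hb2 : (F.filter (fun a => a.1 ∈ insert y (inN F y))).card ≤ sumLargest (Δdeg dm) dp := by
    rw [card_filter_out]
    refine le_trans (sum_le_sum (g := dp) fun i _ => ?_) (sum_le_sumLargest _ _ ?_ hm)
    · rw [← hout i]; omega
    · have := card_insert_le y (inN F y)
      have h2 := card_inN_le F y
      have h3 := hin y
      have h4 := le_Δ dm y
      simp at h3; omega
  have hex : ∃ a ∈ F, a ∉ (F.filter (fun a => a.2 ∈ insert x (outN F x))) ∪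
      (F.filter (fun a => a.1 ∈ insert y (inN F y))) := by
    apply exists_mem_notMem_of_card_lt_card
    refine lt_of_le_of_lt (card_union_le _ _) ?_
    omega
  obtain ⟨⟨p, q⟩, hpq, hn⟩ := hex
  simp only [mem_union, mem_filter, hpq, true_and, mem_insert, mem_outN, mem_inN, not_or] at hn
  obtain ⟨⟨hqx, hxq⟩, hpy, hpy'⟩ := hn
  have hxp : x ≠ p := by rintro rfl; exact hxq hpq
  have hyq : y ≠ q := by rintro rfl; exact hpy' hpq
  have m1 : (p, y) ∉ F.erase (p, q) := fun h => hpy' (mem_of_mem_erase h)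
  have m2 : (x, q) ∉ insert (p, y) (F.erase (p, q)) := by
    simp [hxp, hxq]
  refine ⟨insert (x, q) (insert (p, y) (F.erase (p, q))), ⟨?_, ?_, ?_⟩,
    Or.inr ⟨p, q, mem_insert_self _ _, by simp, ?_, ?_⟩⟩
  · intro a ha
    rcases mem_insert.1 ha with rfl | ha
    · exact Ne.symm hqx
    rcases mem_insert.1 ha with rfl | ha
    · exact hpy
    · exact hl a (mem_of_mem_erase ha)
  · intro i
    have := inDeg_erase' hpq i
    rw [inDeg_insert' m2, inDeg_insert' m1, ← hin i]
    simp only at *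
    omega
  · intro i
    have := outDeg_erase' hpq i
    rw [outDeg_insert' m2, outDeg_insert' m1, ← hout i]
    simp only at *
    omega
  · by_cases e : x = y
    · exact Or.inl e
    · right
      have : (x, y) ∈ F := by
        by_contra h'; exact hxy ⟨e, h'⟩
      simp [this, hxp]
  · rw [erase_insert m2, erase_insert m1, insert_erase hpq]

lemma omega_finite {n : ℕ} (dm dp : Fin n → ℕ) : (OmegaDir dm dp).Finite := Set.toFinite _

lemma count {n N : ℕ} (S T : Set (Finset (Fin n × Fin n)))
    (K : Finset (Fin n × Fin n) → Finset (Finset (Fin n × Fin n)))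
    (hK : ∀ H ∈ T, (K H).card ≤ N) (h : ∀ G ∈ S, ∃ H ∈ T, G ∈ K H) :
    S.ncard ≤ N * T.ncard := by
  classical
  have hT : T.Finite := Set.toFinite _
  have hS : S ⊆ ((hT.toFinset.biUnion K : Finset _) : Set (Finset (Fin n × Fin n))) := by
    intro G hG
    obtain ⟨H, hH, hG⟩ := h G hG
    simp only [coe_biUnion, Set.mem_iUnion]
    exact ⟨H, by simpa using hH, hG⟩
  refine (Set.ncard_le_ncard hS (Set.toFinite _)).trans ?_
  rw [Set.ncard_coe_finset, Set.ncard_eq_toFinset_card T hT, mul_comm]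
  exact card_biUnion_le_card_mul _ _ _ (fun H hH => hK H (by simpa using hH))

lemma case_sub {n : ℕ} (dm dp dm' dp' : Fin n → ℕ) (hm : Δdeg dm ≤ n) (hp : Δdeg dp ≤ n)
    (h : Mdeg dm > sumLargest (Δdeg dm) dp + sumLargest (Δdeg dp) dm
        + 3 * (Δdeg dm + Δdeg dp) + 3) (x y : Fin n)
    (h1 : ∀ i, dm' i + (if i = y then 1 else 0) = dm i)
    (h2 : ∀ i, dp' i + (if i = x then 1 else 0) = dp i) :
    (OmegaDir dm' dp').ncard ≤ Mdeg dm ^ 2 * (OmegaDir dm dp).ncard := by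
  refine count _ _ (fun H => {H.erase (x, y)} ∪ (H ×ˢ H.filter (fun a => a.2 = y)).image
    (fun c => insert (c.2.1, c.1.2) ((H.erase c.1).erase c.2))) ?_ ?_
  · rintro H ⟨_, hi, _⟩
    refine (card_union_le _ _).trans ?_
    refine (Nat.add_le_add_left card_image_le _).trans ?_
    rw [card_product, card_singleton, card_eq_in]
    have : (H.filter (fun a => a.2 = y)).card = dm y := hi y
    rw [this, sum_congr rfl (fun i _ => hi i)]
    have h4 := le_Δ dm y
    change 1 + Mdeg dm * dm y ≤ _
    have : dm y + 1 ≤ Mdeg dm := by omega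
    nlinarith
  · rintro G ⟨hl, hi, ho⟩
    obtain ⟨H, hH, hc⟩ := core dm dp hm hp (by omega) G x y hl (fun i => by rw [hi, h1])
      (fun i => by rw [ho, h2])
    refine ⟨H, hH, ?_⟩
    rcases hc with ⟨_, hc⟩ | ⟨p, q, c1, c2, _, hc⟩
    · simp [← hc]
    · refine mem_union_right _ (mem_image.2 ⟨((x, q), (p, y)), ?_, hc.symm⟩)
      simp [c1, c2]

lemma case_in {n : ℕ} (dm dp dm' : Fin n → ℕ) (hm : Δdeg dm ≤ n) (hp : Δdeg dp ≤ n)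
    (h : Mdeg dm > sumLargest (Δdeg dm) dp + sumLargest (Δdeg dp) dm
        + 3 * (Δdeg dm + Δdeg dp) + 3) (u v : Fin n) (huv : u ≠ v)
    (h1 : ∀ i, dm' i + (if i = v then 1 else 0) = dm i + (if i = u then 1 else 0)) :
    (OmegaDir dm' dp).ncard ≤ Mdeg dm ^ 2 * (OmegaDir dm dp).ncard := by
  refine count _ _ (fun H => H.image (fun a => insert (a.1, u) (H.erase a)) ∪
    (H ×ˢ H.filter (fun a => a.2 = v)).image
    (fun c => insert (c.1.1, u) (insert (c.2.1, c.1.2) ((H.erase c.1).erase c.2)))) ?_ ?_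
  · rintro H ⟨_, hi, _⟩
    refine (card_union_le _ _).trans ?_
    refine (Nat.add_le_add card_image_le card_image_le).trans ?_
    rw [card_product, card_eq_in]
    have : (H.filter (fun a => a.2 = v)).card = dm v := hi v
    rw [this, sum_congr rfl (fun i _ => hi i)]
    have h4 := le_Δ dm v
    change Mdeg dm + Mdeg dm * dm v ≤ _
    have : dm v + 1 ≤ Mdeg dm := by omega
    nlinarith
  · rintro G ⟨hl, hi, ho⟩
    have hpos : 0 < inDeg G u := by
      have := h1 u
      rw [if_neg huv, if_pos rfl] at this
      rw [hi]; omega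
    obtain ⟨⟨x, u'⟩, hx0⟩ := card_pos.1 hpos
    obtain ⟨hx, rfl⟩ := mem_filter.1 hx0
    simp only at *
    obtain ⟨H, hH, hc⟩ := core dm dp hm hp (by omega) (G.erase (x, u')) x v
      (fun a ha => hl a (mem_of_mem_erase ha))
      (fun i => by
        have e1 := inDeg_erase' hx i
        have e2 := h1 i
        have e3 := hi i
        simp only at *
        omega)
      (fun i => by rw [outDeg_erase' hx, ho])
    refine ⟨H, hH, ?_⟩
    rcases hc with ⟨c1, hc⟩ | ⟨p, q, c1, c2, _, hc⟩
    · refine mem_union_left _ (mem_image.2 ⟨(x, v), c1, ?_⟩)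
      simp only
      rw [← hc, insert_erase hx]
    · refine mem_union_right _ (mem_image.2 ⟨((x, q), (p, v)), ?_, ?_⟩)
      · simp [c1, c2]
      · simp only
        rw [← hc, insert_erase hx]

lemma case_out {n : ℕ} (dm dp dp' : Fin n → ℕ) (hm : Δdeg dm ≤ n) (hp : Δdeg dp ≤ n)
    (h : Mdeg dm > sumLargest (Δdeg dm) dp + sumLargest (Δdeg dp) dm
        + 3 * (Δdeg dm + Δdeg dp) + 3) (u v : Fin n) (huv : u ≠ v)
    (h1 : ∀ i, dp' i + (if i = v then 1 else 0) = dp i + (if i = u then 1 else 0)) :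
    (OmegaDir dm dp').ncard ≤ Mdeg dm ^ 2 * (OmegaDir dm dp).ncard := by
  refine count _ _ (fun H => H.image (fun a => insert (u, a.2) (H.erase a)) ∪
    (H.filter (fun a => a.1 = v) ×ˢ H).image
    (fun c => insert (u, c.2.2) (insert (c.2.1, c.1.2) ((H.erase c.1).erase c.2)))) ?_ ?_
  · rintro H ⟨_, hi, ho⟩
    refine (card_union_le _ _).trans ?_
    refine (Nat.add_le_add card_image_le card_image_le).trans ?_
    rw [card_product, card_eq_in]
    have : (H.filter (fun a => a.1 = v)).card = dp v := ho v
    rw [this, sum_congr rfl (fun i _ => hi i)]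
    have h4 := le_Δ dp v
    change Mdeg dm + dp v * Mdeg dm ≤ _
    have : dp v + 1 ≤ Mdeg dm := by omega
    nlinarith
  · rintro G ⟨hl, hi, ho⟩
    have hpos : 0 < outDeg G u := by
      have := h1 u
      rw [if_neg huv, if_pos rfl] at this
      rw [ho]; omega
    obtain ⟨⟨u', y⟩, hx0⟩ := card_pos.1 hpos
    obtain ⟨hx, rfl⟩ := mem_filter.1 hx0
    simp only at *
    obtain ⟨H, hH, hc⟩ := core dm dp hm hp (by omega) (G.erase (u', y)) v y
      (fun a ha => hl a (mem_of_mem_erase ha))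
      (fun i => by rw [inDeg_erase' hx, hi])
      (fun i => by
        have e1 := outDeg_erase' hx i
        have e2 := h1 i
        have e3 := ho i
        simp only at *
        omega)
    refine ⟨H, hH, ?_⟩
    rcases hc with ⟨c1, hc⟩ | ⟨p, q, c1, c2, _, hc⟩
    · refine mem_union_left _ (mem_image.2 ⟨(v, y), c1, ?_⟩)
      simp only
      rw [← hc, insert_erase hx]
    · refine mem_union_right _ (mem_image.2 ⟨((v, q), (p, y)), ?_, ?_⟩)
      · simp [c1, c2]
      · simp only
        rw [← hc, insert_erase hx]

lemma case_add {n : ℕ} (dm dp dm' dp' : Fin n → ℕ) (hm : Δdeg dm ≤ n) (hp : Δdeg dp ≤ n)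
    (h : Mdeg dm > sumLargest (Δdeg dm) dp + sumLargest (Δdeg dp) dm
        + 3 * (Δdeg dm + Δdeg dp) + 3) (u v : Fin n)
    (h1 : ∀ i, dm' i = dm i + (if i = u then 1 else 0))
    (h2 : ∀ i, dp' i = dp i + (if i = v then 1 else 0)) :
    (OmegaDir dm' dp').ncard ≤ Mdeg dm ^ 2 * (OmegaDir dm dp).ncard := by
  refine count _ _ (fun H => ({insert (v, u) H} ∪
    H.image (fun a => insert (v, a.2) (insert (a.1, u) (H.erase a)))) ∪
    (H.biUnion (fun a => (H.filter (fun b => b.2 ∈ insert a.1 (outN H a.1))).image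
      (fun b => insert (v, b.2) (insert (a.1, u)
        (insert (b.1, a.2) ((H.erase a).erase b))))))) ?_ ?_
  · rintro H ⟨_, hi, ho⟩
    have hc : H.card = Mdeg dm := by
      rw [card_eq_in, sum_congr rfl (fun i _ => hi i)]; rfl
    have hb : ∀ x, (H.filter (fun b => b.2 ∈ insert x (outN H x))).card ≤
        sumLargest (Δdeg dp) dm + Δdeg dm := by
      intro x
      rw [card_filter_in, sum_congr rfl (fun i _ => hi i)]
      have e1 : ∑ i ∈ insert x (outN H x), dm i ≤ dm x + ∑ i ∈ outN H x, dm i := by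
        by_cases hx : x ∈ outN H x
        · rw [insert_eq_of_mem hx]; omega
        · rw [sum_insert hx]
      have e2 := sum_le_sumLargest dm (outN H x)
        ((card_outN_le H x).trans ((ho x).trans_le (le_Δ dp x))) hp
      have e3 := le_Δ dm x
      refine le_trans e1 ?_
      omega
    refine (card_union_le _ _).trans ?_
    refine (Nat.add_le_add ((card_union_le _ _).trans (Nat.add_le_add_left card_image_le _))
      (card_biUnion_le_card_mul _ _ (sumLargest (Δdeg dp) dm + Δdeg dm)
        (fun a _ => card_image_le.trans (hb a.1)))).trans ?_
    rw [card_singleton, hc]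
    have : sumLargest (Δdeg dp) dm + Δdeg dm + 2 ≤ Mdeg dm := by omega
    nlinarith
  · rintro G ⟨hl, hi, ho⟩
    by_cases hvu : (v, u) ∈ G
    · refine ⟨G.erase (v, u), ⟨fun a ha => hl a (mem_of_mem_erase ha), ?_, ?_⟩, ?_⟩
      · intro i
        have e1 := inDeg_erase' hvu i
        have e2 := h1 i
        have e3 := hi i
        simp only at *
        omega
      · intro i
        have e1 := outDeg_erase' hvu i
        have e2 := h2 i
        have e3 := ho i
        simp only at *
        omega
      · simp [insert_erase hvu]
    have hpos : 0 < outDeg G v := by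
      rw [ho, h2]; simp
    obtain ⟨⟨v', y⟩, hy0⟩ := card_pos.1 hpos
    obtain ⟨hy, rfl⟩ := mem_filter.1 hy0
    have hpos : 0 < inDeg G u := by
      rw [hi, h1]; simp
    obtain ⟨⟨x, u'⟩, hx0⟩ := card_pos.1 hpos
    obtain ⟨hx, rfl⟩ := mem_filter.1 hx0
    simp only at *
    have hx' : (x, u') ∈ G.erase (v', y) := by
      refine mem_erase.2 ⟨?_, hx⟩
      intro e
      rw [Prod.mk.injEq] at e
      rw [← e.1] at hvu
      exact hvu hx
    have back : insert (v', y) (insert (x, u') ((G.erase (v', y)).erase (x, u'))) = G := by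
      rw [insert_erase hx', insert_erase hy]
    obtain ⟨H, hH, hc⟩ := core dm dp hm hp (by omega) ((G.erase (v', y)).erase (x, u')) x y
      (fun a ha => hl a (mem_of_mem_erase (mem_of_mem_erase ha)))
      (fun i => by
        have e1 := inDeg_erase' hx' i
        have e0 := inDeg_erase' hy i
        have e2 := h1 i
        have e3 := hi i
        simp only at *
        omega)
      (fun i => by
        have e1 := outDeg_erase' hx' i
        have e0 := outDeg_erase' hy i
        have e2 := h2 i
        have e3 := ho i
        simp only at *
        omega)
    refine ⟨H, hH, ?_⟩
    rcases hc with ⟨c1, hc⟩ | ⟨p, q, c1, c2, c3, hc⟩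
    · refine mem_union_left _ (mem_union_right _ (mem_image.2 ⟨(x, y), c1, ?_⟩))
      simp only
      rw [← hc, back]
    · refine mem_union_right _ (mem_biUnion.2 ⟨(x, q), c1, mem_image.2 ⟨(p, y), ?_, ?_⟩⟩)
      · simp only [mem_filter, c2, true_and, mem_insert, mem_outN]
        rcases c3 with c3 | c3
        · exact Or.inl c3.symm
        · exact Or.inr c3
      · simp only
        rw [← hc, back]

lemma vec_le_one {n : ℕ} (f : Fin n → ℤ) (h : ∑ i, (f i).natAbs ≤ 1) :
    (∀ i, f i = 0) ∨ (∃ u, ∀ i, f i = if i = u then 1 else 0) ∨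
      (∃ u, ∀ i, f i = if i = u then -1 else 0) := by
  by_cases h0 : ∀ i, f i = 0
  · exact Or.inl h0
  right
  push Not at h0
  obtain ⟨u, hu⟩ := h0
  have key : ∀ i, i ≠ u → (f i).natAbs + (f u).natAbs ≤ 1 := by
    intro i hi
    rw [← sum_pair (f := fun i => (f i).natAbs) hi]
    exact (sum_le_sum_of_subset (subset_univ _)).trans h
  have ku : (f u).natAbs ≤ 1 :=
    (single_le_sum (f := fun i => (f i).natAbs) (fun _ _ => Nat.zero_le _) (mem_univ u)).trans h
  have : f u = 1 ∨ f u = -1 := by omega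
  rcases this with e | e
  · left
    refine ⟨u, fun i => ?_⟩
    split_ifs with hi
    · rw [hi, e]
    · have := key i hi; omega
  · right
    refine ⟨u, fun i => ?_⟩
    split_ifs with hi
    · rw [hi, e]
    · have := key i hi; omega

lemma vec_le_two {n : ℕ} (f : Fin n → ℤ) (h : ∑ i, (f i).natAbs ≤ 2) (h0 : ∑ i, f i = 0) :
    (∀ i, f i = 0) ∨ (∃ u v, u ≠ v ∧ ∀ i, f i + (if i = v then 1 else 0) =
      if i = u then 1 else 0) := by
  by_cases hz : ∀ i, f i = 0
  · exact Or.inl hz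
  right
  push Not at hz
  obtain ⟨w, hw⟩ := hz
  obtain ⟨u, -, hu⟩ := exists_pos_of_sum_zero_of_exists_nonzero f h0 ⟨w, mem_univ _, hw⟩
  obtain ⟨v, -, hv⟩ := exists_pos_of_sum_zero_of_exists_nonzero (fun i => - f i)
    (by rw [sum_neg_distrib, h0, neg_zero]) ⟨w, mem_univ _, by simpa using hw⟩
  have huv : u ≠ v := by rintro rfl; omega
  have key2 : (f u).natAbs + (f v).natAbs ≤ 2 := by
    rw [← sum_pair (f := fun i => (f i).natAbs) huv]
    exact (sum_le_sum_of_subset (subset_univ _)).trans h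
  have key : ∀ i, i ≠ u → i ≠ v → (f i).natAbs + ((f u).natAbs + (f v).natAbs) ≤ 2 := by
    intro i hi hi'
    rw [← sum_pair (f := fun i => (f i).natAbs) huv,
      ← sum_insert (f := fun i => (f i).natAbs) (by simp [hi, hi'])]
    exact (sum_le_sum_of_subset (subset_univ _)).trans h
  refine ⟨u, v, huv, fun i => ?_⟩
  by_cases e1 : i = u
  · subst e1; rw [if_neg huv, if_pos rfl]; omega
  by_cases e2 : i = v
  · subst e2; rw [if_neg e1, if_pos rfl]; omega
  have := key i e1 e2
  rw [if_neg e1, if_neg e2]; omega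

theorem stmt_13 {n : ℕ} (dm dp : Fin n → ℕ) (hsum : ∑ i, dm i = ∑ i, dp i)
    (hd : DigraphicalDir dm dp)
    (h : Mdeg dm >
      sumLargest (Δdeg dm) dp + sumLargest (Δdeg dp) dm
        + 3 * (Δdeg dm + Δdeg dp) + 3) :
    StableDir 2 2 dm dp := by
  intro dm' dp' hd' hk
  suffices hh : (OmegaDir dm' dp').ncard ≤ Mdeg dm ^ 2 * (OmegaDir dm dp).ncard by
    rw [Real.rpow_two]
    exact_mod_cast hh
  obtain ⟨A, _, hAi, hAo⟩ := hd
  have hm : Δdeg dm ≤ n := Finset.sup_le fun i _ => by rw [← hAi]; exact inDeg_le _ _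
  have hp : Δdeg dp ≤ n := Finset.sup_le fun i _ => by rw [← hAo]; exact outDeg_le _ _
  have hsum' : ∑ i, dm' i = ∑ i, dp' i := by
    obtain ⟨B, _, hBi, hBo⟩ := hd'
    rw [← sum_congr rfl (fun i _ => hBi i), ← sum_congr rfl (fun i _ => hBo i),
      ← card_filter_in, ← card_filter_out]
    simp
  have hs : ∑ i, ((dm' i : ℤ) - dm i) = ∑ i, ((dp' i : ℤ) - dp i) := by
    rw [sum_sub_distrib, sum_sub_distrib]
    have e1 : (∑ i, (dm i : ℤ)) = ∑ i, (dp i : ℤ) := by exact_mod_cast hsum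
    have e2 : (∑ i, (dm' i : ℤ)) = ∑ i, (dp' i : ℤ) := by exact_mod_cast hsum'
    rw [e1, e2]
  unfold l1dist at hk
  have trivial_case : dm' = dm → dp' = dp →
      (OmegaDir dm' dp').ncard ≤ Mdeg dm ^ 2 * (OmegaDir dm dp).ncard := by
    rintro rfl rfl
    exact Nat.le_mul_of_pos_left _ (pow_pos (by omega) 2)
  have eqz : ∀ d' d : Fin n → ℕ, (∀ i, (d' i : ℤ) - d i = 0) → d' = d := by
    intro d' d hh; funext i; have := hh i; omega
  have z0 : ∀ d' d : Fin n → ℕ, ∑ i, ((d' i : ℤ) - d i).natAbs = 0 → d' = d := by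
    intro d' d hh
    refine eqz _ _ fun i => ?_
    have := (sum_eq_zero_iff.1 hh) i (mem_univ i)
    omega
  rcases Nat.eq_zero_or_pos (∑ i, ((dm' i : ℤ) - dm i).natAbs) with a0 | a0
  · have e := z0 _ _ a0
    rcases vec_le_two (fun i => (dp' i : ℤ) - dp i) (by omega)
      (by rw [← hs, e]; simp) with hz | ⟨u, v, huv, hz⟩
    · exact trivial_case e (eqz _ _ hz)
    · rw [e]
      refine case_out dm dp dp' hm hp h u v huv fun i => ?_
      have := hz i
      split_ifs at * <;> omega
  rcases Nat.eq_zero_or_pos (∑ i, ((dp' i : ℤ) - dp i).natAbs) with b0 | b0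
  · have e := z0 _ _ b0
    rcases vec_le_two (fun i => (dm' i : ℤ) - dm i) (by omega)
      (by rw [hs, e]; simp) with hz | ⟨u, v, huv, hz⟩
    · exact trivial_case (eqz _ _ hz) e
    · rw [e]
      refine case_in dm dp dm' hm hp h u v huv fun i => ?_
      have := hz i
      split_ifs at * <;> omega
  rcases vec_le_one (fun i => (dm' i : ℤ) - dm i) (by omega) with
    ha | ⟨u, ha⟩ | ⟨u, ha⟩
  · exfalso
    simp [ha] at a0
  · rcases vec_le_one (fun i => (dp' i : ℤ) - dp i) (by omega) with
      hb | ⟨v, hb⟩ | ⟨v, hb⟩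
    · exfalso
      simp [hb] at b0
    · refine case_add dm dp dm' dp' hm hp h u v (fun i => ?_) (fun i => ?_)
      · have := ha i
        split_ifs at * <;> omega
      · have := hb i
        split_ifs at * <;> omega
    · exfalso
      rw [sum_congr rfl (fun i _ => ha i), sum_congr rfl (fun i _ => hb i)] at hs
      simp at hs
  · rcases vec_le_one (fun i => (dp' i : ℤ) - dp i) (by omega) with
      hb | ⟨v, hb⟩ | ⟨v, hb⟩
    · exfalso
      simp [hb] at b0
    · exfalso
      rw [sum_congr rfl (fun i _ => ha i), sum_congr rfl (fun i _ => hb i)] at hs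
      simp at hs
    · refine case_sub dm dp dm' dp' hm hp h v u (fun i => ?_) (fun i => ?_)
      · have := ha i
        split_ifs at * <;> omega
      · have := hb i
        split_ifs at * <;> omega
end

section
/- Let d be a graphical degree sequence of length n with M(d) > 2·J(d) + 6·Δ(d) + 2. Then for every graph G ∈ Ω'(d) there is a sequence of graphs G = G₀, G₁, …, G_m on {1,…,n} with m ≤ 3 such that each G_t ∈ Ω'(d), G_m ∈ Ω(d), and for each t < m the graph G_{t+1} is obtained from G_t by a single Jerrum–Sinclair move (an edge insertion, an edge deletion, or a hinge flip). -/
open Finset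

/-- `H` is obtained from `G` by a single Jerrum–Sinclair move: an edge insertion,
an edge deletion, or a hinge flip. -/
def JSmove {n : ℕ} (G H : SimpleGraph (Fin n)) : Prop :=
  (∃ e : Sym2 (Fin n), ¬ e.IsDiag ∧ e ∉ G.edgeSet ∧
      H.edgeSet = insert e G.edgeSet) ∨
  (∃ e : Sym2 (Fin n), e ∈ G.edgeSet ∧ H.edgeSet = G.edgeSet \ {e}) ∨
  (∃ u v w : Fin n, G.Adj u v ∧ w ≠ u ∧ w ≠ v ∧ ¬ G.Adj w v ∧
      H.edgeSet = insert s(w, v) (G.edgeSet \ {s(u, v)}))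

theorem aux_deg_insert {n : ℕ} {G H : SimpleGraph (Fin n)} {a b : Fin n} (hab : a ≠ b)
    (hG : ¬ G.Adj a b) (hH : H.edgeSet = insert s(a, b) G.edgeSet) (i : Fin n) :
    degOf H i = degOf G i + ((if i = a then 1 else 0) + (if i = b then 1 else 0)) := by
  have hadj : ∀ x y, H.Adj x y ↔ ((x = a ∧ y = b) ∨ (x = b ∧ y = a)) ∨ G.Adj x y := by
    intro x y
    rw [← SimpleGraph.mem_edgeSet, hH, Set.mem_insert_iff, SimpleGraph.mem_edgeSet]
    simp
  unfold degOf
  by_cases h1 : i = a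
  · subst h1
    have : H.neighborSet i = insert b (G.neighborSet i) := by
      ext y
      simp only [SimpleGraph.mem_neighborSet, hadj, Set.mem_insert_iff]
      grind
    rw [this, Set.ncard_insert_of_notMem (by simpa using hG) (Set.toFinite _)]
    simp [hab]
  · by_cases h2 : i = b
    · subst h2
      have : H.neighborSet i = insert a (G.neighborSet i) := by
        ext y
        simp only [SimpleGraph.mem_neighborSet, hadj, Set.mem_insert_iff]
        grind
      rw [this, Set.ncard_insert_of_notMem (by simpa [SimpleGraph.adj_comm] using hG)
        (Set.toFinite _)]
      simp [h1]
    · have : H.neighborSet i = G.neighborSet i := by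
        ext y
        simp only [SimpleGraph.mem_neighborSet, hadj]
        grind
      rw [this]; simp [h1, h2]

theorem aux_degOf_sum {n : ℕ} (G : SimpleGraph (Fin n)) [DecidableRel G.Adj] (i : Fin n) :
    degOf G i = ∑ j, if G.Adj i j then 1 else 0 := by
  unfold degOf
  rw [Set.ncard_eq_toFinset_card', ← SimpleGraph.neighborFinset_def,
    SimpleGraph.neighborFinset_eq_filter, Finset.card_filter]

theorem aux_even {n : ℕ} (G : SimpleGraph (Fin n)) : Even (∑ i, degOf G i) := by
  classical
  have : ∀ i, degOf G i = G.degree i := by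
    intro i
    unfold degOf
    rw [Set.ncard_eq_toFinset_card', ← SimpleGraph.neighborFinset_def]
    rfl
  simp_rw [this, SimpleGraph.sum_degrees_eq_twice_card_edges]
  exact even_two_mul _

theorem aux_mem {n : ℕ} {d : Fin n → ℕ} {G : SimpleGraph (Fin n)} (a b : Fin n)
    (hG : ∀ i, d i = degOf G i + ((if i = a then 1 else 0) + (if i = b then 1 else 0))) :
    G ∈ OmegaPrime d := by
  simp only [OmegaPrime, Set.mem_iUnion, Set.mem_setOf_eq, exists_prop]
  refine ⟨degOf G, ⟨⟨G, fun _ => rfl⟩, fun j => by rw [hG j]; omega, ?_⟩, fun _ => rfl⟩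
  unfold l1dist
  have : ∀ i, ((d i : ℤ) - (degOf G i : ℤ)).natAbs
      = ((if i = a then 1 else 0) + (if i = b then 1 else 0)) := by
    intro i; have := hG i; omega
  simp_rw [this, Finset.sum_add_distrib]
  simp

theorem aux_mem0 {n : ℕ} {d : Fin n → ℕ} {G : SimpleGraph (Fin n)}
    (hG : ∀ i, degOf G i = d i) : G ∈ OmegaPrime d := by
  simp only [OmegaPrime, Set.mem_iUnion, Set.mem_setOf_eq, exists_prop]
  refine ⟨degOf G, ⟨⟨G, fun _ => rfl⟩, fun j => (hG j).le, ?_⟩, fun _ => rfl⟩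
  simp [l1dist, hG]

theorem aux_J {n : ℕ} {d : Fin n → ℕ} (hn : Δdeg d ≤ n) (A : Finset (Fin n))
    (hA : A.card ≤ Δdeg d) : ∑ i ∈ A, d i ≤ Jdeg d := by
  obtain ⟨B, hAB, hB⟩ := Finset.exists_superset_card_eq hA (by simpa using hn)
  calc ∑ i ∈ A, d i ≤ ∑ i ∈ B, d i := Finset.sum_le_sum_of_subset hAB
    _ ≤ Jdeg d := by
      have hmem : B ∈ (Finset.univ : Finset (Fin n)).powersetCard (Δdeg d) := by
        rw [Finset.mem_powersetCard]; exact ⟨Finset.subset_univ _, hB⟩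
      exact Finset.le_sup (f := fun S => ∑ i ∈ S, d i) hmem

theorem aux_edge {n : ℕ} {d : Fin n → ℕ} {G : SimpleGraph (Fin n)} (hn : Δdeg d ≤ n)
    (hle : ∀ i, degOf G i ≤ d i) (u v : Fin n) (hu : degOf G u < d u) (hv : degOf G v < d v)
    (hsum : 2 * Jdeg d < ∑ i, degOf G i) :
    ∃ x y, G.Adj x y ∧ x ≠ u ∧ ¬ G.Adj u x ∧ y ≠ v ∧ ¬ G.Adj v y := by
  classical
  by_contra hcon
  have hN : ∀ w, degOf G w < d w → ∑ i ∈ insert w (G.neighborFinset w), degOf G i ≤ Jdeg d := by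
    intro w hw
    refine (Finset.sum_le_sum fun i _ => hle i).trans (aux_J hn _ ?_)
    refine (Finset.card_insert_le _ _).trans ?_
    have h1 : (G.neighborFinset w).card = degOf G w := by
      unfold degOf
      rw [Set.ncard_eq_toFinset_card', ← SimpleGraph.neighborFinset_def]
    have h2 : d w ≤ Δdeg d := Finset.le_sup (f := d) (Finset.mem_univ w)
    omega
  have key : ∑ i, degOf G i ≤ ∑ i ∈ insert u (G.neighborFinset u), degOf G i
      + ∑ i ∈ insert v (G.neighborFinset v), degOf G i := by
    have e1 : ∀ A : Finset (Fin n), ∑ i ∈ A, degOf G i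
        = ∑ x, ∑ y, if x ∈ A ∧ G.Adj x y then 1 else 0 := by
      intro A
      rw [← Finset.sum_subset (Finset.subset_univ A)]
      · refine Finset.sum_congr rfl fun x hx => ?_
        simp [aux_degOf_sum, hx]
      · intro x _ hx; simp [hx]
    rw [e1 (insert v _), Finset.sum_comm, e1 (insert u _), ← Finset.sum_add_distrib]
    refine Finset.sum_le_sum fun x _ => ?_
    rw [aux_degOf_sum, ← Finset.sum_add_distrib]
    refine Finset.sum_le_sum fun y _ => ?_
    by_cases hxy : G.Adj x y
    · have hyx := hxy.symm
      by_cases hx : x ∈ insert u (G.neighborFinset u)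
      · simp only [hxy, hx]; simp
      · by_cases hy : y ∈ insert v (G.neighborFinset v)
        · simp only [hyx, hxy, hy]; simp
        · exfalso
          simp only [Finset.mem_insert, SimpleGraph.mem_neighborFinset, not_or] at hx hy
          exact hcon ⟨x, y, hxy, hx.1, hx.2, hy.1, hy.2⟩
    · simp [hxy]
  have := hN u hu
  have := hN v hv
  omega

theorem aux_split {n : ℕ} (f : Fin n → ℕ) (hf : ∑ i, f i = 2) :
    ∃ a b, ∀ i, f i = (if i = a then 1 else 0) + (if i = b then 1 else 0) := by
  have step : ∀ (f : Fin n → ℕ) (k : ℕ), ∑ i, f i = k + 1 →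
      ∃ (a : Fin n) (g : Fin n → ℕ), (∑ i, g i = k) ∧ ∀ i, f i = (if i = a then 1 else 0) + g i := by
    intro f k hk
    obtain ⟨a, -, ha⟩ := Finset.exists_ne_zero_of_sum_ne_zero (s := Finset.univ) (f := f) (by omega)
    have hg : ∀ i, f i = (if i = a then 1 else 0) + (f i - if i = a then 1 else 0) := by
      intro i
      by_cases h : i = a
      · subst h; simp; omega
      · simp [h]
    refine ⟨a, fun i => f i - if i = a then 1 else 0, ?_, hg⟩
    have := Finset.sum_congr (rfl : (Finset.univ : Finset (Fin n)) = _) fun i _ => hg i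
    rw [Finset.sum_add_distrib, hk] at this
    simp at this
    simp; omega
  obtain ⟨a, g, hg, h1⟩ := step f 1 hf
  obtain ⟨b, k, hk, h2⟩ := step g 0 hg
  refine ⟨a, b, fun i => ?_⟩
  have : k i = 0 := by
    simpa using (Finset.sum_eq_zero_iff.mp hk) i (Finset.mem_univ i)
  rw [h1, h2, this]; rfl

theorem aux_exists_insert {n : ℕ} (G : SimpleGraph (Fin n)) {a b : Fin n} (hab : a ≠ b) :
    ∃ H : SimpleGraph (Fin n), H.edgeSet = insert s(a, b) G.edgeSet := by
  refine ⟨G ⊔ SimpleGraph.fromEdgeSet {s(a, b)}, ?_⟩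
  rw [SimpleGraph.edgeSet_sup, SimpleGraph.edgeSet_fromEdgeSet]
  ext e
  simp only [Set.mem_union, Set.mem_diff, Set.mem_singleton_iff, Set.mem_insert_iff]
  constructor
  · tauto
  · rintro (rfl | h)
    · right; simpa using hab
    · left; exact h

theorem stmt_17 {n : ℕ} (d : Fin n → ℕ) (hd : Graphical d)
    (h : Mdeg d > 2 * Jdeg d + 6 * Δdeg d + 2) :
    ∀ G ∈ OmegaPrime d, ∃ (m : ℕ) (seq : ℕ → SimpleGraph (Fin n)),
      m ≤ 3 ∧ seq 0 = G ∧ (∀ t ≤ m, seq t ∈ OmegaPrime d) ∧ seq m ∈ Omega d ∧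
      ∀ t < m, JSmove (seq t) (seq (t + 1)) := by
  intro G hG
  have hG0 := hG
  simp only [OmegaPrime, Set.mem_iUnion, Set.mem_setOf_eq, exists_prop] at hG
  obtain ⟨d', ⟨-, hle, hl1⟩, hGd⟩ := hG
  have hGd : ∀ i, degOf G i = d' i := hGd
  obtain ⟨G₀, hG₀⟩ := hd
  have hG₀ : ∀ i, degOf G₀ i = d i := hG₀
  have ev1 := aux_even G
  have ev2 := aux_even G₀
  simp_rw [hG₀] at ev2
  have hle' : ∀ i, degOf G i ≤ d i := fun i => by rw [hGd]; exact hle i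
  have hfi : ∀ i, d i = degOf G i + (d i - degOf G i) := fun i => by have := hle' i; omega
  have hsum : ∑ i, d i = ∑ i, degOf G i + ∑ i, (d i - degOf G i) := by
    rw [← Finset.sum_add_distrib]; exact Finset.sum_congr rfl fun i _ => hfi i
  have hl : ∑ i, (d i - degOf G i) ≤ 2 := by
    refine le_trans (le_of_eq ?_) hl1
    unfold l1dist
    refine Finset.sum_congr rfl fun i _ => ?_
    have := hle' i; have := hGd i; omega
  have hcase : ∑ i, (d i - degOf G i) = 0 ∨ ∑ i, (d i - degOf G i) = 2 := by
    rw [Nat.even_iff] at ev1 ev2; omega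
  rcases hcase with h0 | h2
  · have hGO : ∀ i, degOf G i = d i := by
      intro i
      have := (Finset.sum_eq_zero_iff.mp h0) i (Finset.mem_univ i)
      have := hle' i; omega
    exact ⟨0, fun _ => G, by omega, rfl, fun _ _ => hG0, hGO, fun t ht => by omega⟩
  obtain ⟨u, v, huv⟩ := aux_split _ h2
  have hdG : ∀ i, d i = degOf G i + ((if i = u then 1 else 0) + (if i = v then 1 else 0)) :=
    fun i => by rw [← huv]; exact hfi i
  by_cases hc : u ≠ v ∧ ¬ G.Adj u v
  · obtain ⟨H, hH⟩ := aux_exists_insert G hc.1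
    have hHd : ∀ i, degOf H i = d i := fun i => by
      rw [aux_deg_insert hc.1 hc.2 hH, hdG]
    refine ⟨1, fun t => if t = 0 then G else H, by omega, rfl, ?_, hHd, ?_⟩
    · intro t _
      dsimp only
      split_ifs
      · exact hG0
      · exact aux_mem0 hHd
    · intro t ht
      obtain rfl : t = 0 := by omega
      exact Or.inl ⟨s(u, v), by simpa using hc.1, by simpa using hc.2, hH⟩
  have hc' : u = v ∨ G.Adj u v := by tauto
  have hn : Δdeg d ≤ n := by
    refine Finset.sup_le fun i _ => ?_
    rw [← hG₀ i]
    calc _ ≤ (Set.univ : Set (Fin n)).ncard := Set.ncard_le_ncard (Set.subset_univ _) (Set.toFinite _)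
      _ = n := by simp
  have hsumG : 2 * Jdeg d < ∑ i, degOf G i := by
    unfold Mdeg at h; omega
  obtain ⟨x, y, hxy, hxu, hux, hyv, hvy⟩ := aux_edge hn hle' u v
    (by rw [hdG u]; simp) (by rw [hdG v]; simp) hsumG
  have hne : x ≠ y := hxy.ne
  have hyu : y ≠ u := by
    rintro rfl; exact hux hxy.symm
  have hxv : x ≠ v := by
    rintro rfl; exact hvy hxy
  -- the intermediate graphs
  let K := G.deleteEdges {s(x, y)}
  have hKe : K.edgeSet = G.edgeSet \ {s(x, y)} := SimpleGraph.edgeSet_deleteEdges _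
  have hGK : G.edgeSet = insert s(x, y) K.edgeSet := by
    rw [hKe, Set.insert_diff_singleton, Set.insert_eq_of_mem]
    exact hxy
  have hKadj : ∀ a b, K.Adj a b → G.Adj a b := fun a b hab => G.deleteEdges_le _ hab
  have hKxy : ¬ K.Adj x y := by
    rw [← SimpleGraph.mem_edgeSet, hKe]; simp
  obtain ⟨H, hH⟩ := aux_exists_insert K hxu.symm
  have hKux : ¬ K.Adj u x := fun hh => hux (hKadj _ _ hh)
  have hHvy : ¬ H.Adj v y := by
    rw [← SimpleGraph.mem_edgeSet, hH, Set.mem_insert_iff, not_or]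
    refine ⟨?_, fun hh => hvy (hKadj _ _ hh)⟩
    simp only [Sym2.eq_iff]
    grind
  obtain ⟨L, hL⟩ := aux_exists_insert H hyv.symm
  have dG := aux_deg_insert hne hKxy hGK
  have dH := aux_deg_insert hxu.symm hKux hH
  have dL := aux_deg_insert hyv.symm hHvy hL
  have hHd : ∀ i, d i = degOf H i + ((if i = v then 1 else 0) + (if i = y then 1 else 0)) := by
    intro i
    rw [hdG, dG, dH]; ring
  have hLd : ∀ i, degOf L i = d i := fun i => by rw [dL, hHd]
  refine ⟨2, fun t => if t = 0 then G else if t = 1 then H else L, by omega, rfl, ?_, hLd, ?_⟩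
  · intro t _
    dsimp only
    split_ifs
    · exact hG0
    · exact aux_mem v y hHd
    · exact aux_mem0 hLd
  · intro t ht
    obtain rfl | rfl : t = 0 ∨ t = 1 := by omega
    · refine Or.inr (Or.inr ⟨y, x, u, hxy.symm, hyu.symm, hxu.symm, hux, ?_⟩)
      have e : H.edgeSet = insert s(u, x) (G.edgeSet \ {s(y, x)}) := by
        rw [Sym2.eq_swap (a := y), ← hKe]
        exact hH
      exact e
    · exact Or.inl ⟨s(v, y), by simpa using hyv.symm, by simpa using hHvy, hL⟩
end

section
/- Let d be a graphical degree sequence of length n, let i ≠ j be two indices with d_i ≥ 1 and d_j ≥ 1, and suppose that d' = d − e_i − e_j is graphical, where e_t denotes the t-th standard unit vector. Let G' ∈ Ω(d'). Then the number of ordered pairs (u₁,u₂) of vertices of G' such that the four vertices i, j, u₁, u₂ are pairwise distinct, u₁u₂ is an edge of G', and neither iu₁ nor ju₂ is an edge of G', is at least M(d) − 2·J(d) − 2·Δ(d) − 2, where this lower bound is interpreted as an integer (so the claim is vacuous when it is negative). -/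
open Finset

open Classical in
theorem degOf_card {n : ℕ} (G : SimpleGraph (Fin n)) (i : Fin n) :
    degOf G i = (univ.filter (fun x => G.Adj i x)).card := by
  unfold degOf
  rw [← Set.ncard_coe_finset]
  congr 1
  ext x
  simp

open Classical in
theorem card_left {n : ℕ} (G : SimpleGraph (Fin n)) (S : Finset (Fin n)) :
    ((univ : Finset (Fin n × Fin n)).filter (fun p => G.Adj p.1 p.2 ∧ p.1 ∈ S)).card
      = ∑ s ∈ S, degOf G s := by
  have : (univ : Finset (Fin n × Fin n)).filter (fun p => G.Adj p.1 p.2 ∧ p.1 ∈ S)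
      = (S ×ˢ univ).filter (fun p => G.Adj p.1 p.2) := by
    ext p; simp [and_comm]
  rw [this, Finset.card_filter, Finset.sum_product]
  refine Finset.sum_congr rfl fun s _ => ?_
  rw [degOf_card, Finset.card_filter]

open Classical in
theorem card_right {n : ℕ} (G : SimpleGraph (Fin n)) (S : Finset (Fin n)) :
    ((univ : Finset (Fin n × Fin n)).filter (fun p => G.Adj p.1 p.2 ∧ p.2 ∈ S)).card
      = ∑ s ∈ S, degOf G s := by
  rw [← card_left]
  refine Finset.card_bij (fun p _ => p.swap) ?_ ?_ ?_
  · intro p hp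
    simpa [G.adj_comm] using hp
  · intro p _ q _ h
    exact Prod.swap_injective h
  · intro p hp
    exact ⟨p.swap, by simpa [G.adj_comm] using hp, by simp⟩

theorem sum_le_J {n : ℕ} (d : Fin n → ℕ) (hd : Graphical d) (S : Finset (Fin n))
    (hS : S.card ≤ Δdeg d) : ∑ s ∈ S, d s ≤ Jdeg d := by
  have hn : Δdeg d ≤ Fintype.card (Fin n) := by
    obtain ⟨G, hG⟩ := hd
    refine Finset.sup_le fun t _ => ?_
    rw [← hG t, degOf_card]
    exact Finset.card_le_univ _
  obtain ⟨T, hST, hT⟩ := Finset.exists_superset_card_eq hS hn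
  calc ∑ s ∈ S, d s ≤ ∑ s ∈ T, d s := Finset.sum_le_sum_of_subset hST
    _ ≤ _ := Finset.le_sup (f := fun S => ∑ i ∈ S, d i)
        (Finset.mem_powersetCard.2 ⟨Finset.subset_univ _, hT⟩)

/-- lower bound on the number of `(i⁺,j⁺)`-switchings, Case 2a
of Theorem 3.4: for `G' ∈ Ω(d - eᵢ - eⱼ)`, the number of pairs `(u₁,u₂)`
defining an `(i⁺,j⁺)`-switching is at least `M(d) - 2J(d) - 2Δ(d) - 2`. -/
theorem stmt_19 {n : ℕ} (d : Fin n → ℕ) (hd : Graphical d) (i j : Fin n)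
    (hij : i ≠ j) (hi : 1 ≤ d i) (hj : 1 ≤ d j)
    (hd' : Graphical (fun t => d t - (Pi.single i 1 : Fin n → ℕ) t - (Pi.single j 1 : Fin n → ℕ) t))
    (G' : SimpleGraph (Fin n))
    (hG' : G' ∈ Omega (fun t => d t - (Pi.single i 1 : Fin n → ℕ) t - (Pi.single j 1 : Fin n → ℕ) t)) :
    (Mdeg d : ℤ) - 2 * (Jdeg d : ℤ) - 2 * (Δdeg d : ℤ) - 2
      ≤ (({p : Fin n × Fin n |
            p.1 ≠ i ∧ p.1 ≠ j ∧ p.2 ≠ i ∧ p.2 ≠ j ∧ p.1 ≠ p.2 ∧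
            G'.Adj p.1 p.2 ∧ ¬ G'.Adj i p.1 ∧ ¬ G'.Adj j p.2} :
          Set (Fin n × Fin n)).ncard : ℤ) := by
  classical
  have hG : ∀ t, degOf G' t =
    d t - (Pi.single i 1 : Fin n → ℕ) t - (Pi.single j 1 : Fin n → ℕ) t := hG'
  have hle : ∀ t, degOf G' t ≤ d t := fun t => by rw [hG]; omega
  have hgi : degOf G' i + 1 = d i := by
    rw [hG]; simp [hij]; omega
  have hgj : degOf G' j + 1 = d j := by
    rw [hG]; simp [hij.symm]; omega
  have hΔ : ∀ t, d t ≤ Δdeg d := fun t => Finset.le_sup (f := d) (Finset.mem_univ t)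
  have hM : Mdeg d ≤ ∑ t, degOf G' t + 2 := by
    have h1 : ∀ t, d t ≤ degOf G' t + ((Pi.single i 1 : Fin n → ℕ) t
        + (Pi.single j 1 : Fin n → ℕ) t) := fun t => by rw [hG]; omega
    have h2 := Finset.sum_le_sum (s := univ) fun t _ => h1 t
    rw [Finset.sum_add_distrib, Finset.sum_add_distrib] at h2
    simpa [Mdeg] using h2
  have key : ∀ v, degOf G' v + 1 = d v →
      ∑ s ∈ insert v (univ.filter (fun x => G'.Adj v x)), degOf G' s ≤ Jdeg d := by
    intro v hv
    refine (Finset.sum_le_sum fun t _ => hle t).trans (sum_le_J d hd _ ?_)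
    refine (Finset.card_insert_le _ _).trans ?_
    rw [← degOf_card, hv]
    exact hΔ v
  have k1 := key i hgi
  have k2 := key j hgj
  rw [← card_left] at k1
  rw [← card_right] at k2
  have k3 := card_left G' {j}
  have k4 := card_right G' {i}
  have k5 := card_left G' univ
  rw [Finset.sum_singleton] at k3 k4
  set X := ({p : Fin n × Fin n |
            p.1 ≠ i ∧ p.1 ≠ j ∧ p.2 ≠ i ∧ p.2 ≠ j ∧ p.1 ≠ p.2 ∧
            G'.Adj p.1 p.2 ∧ ¬ G'.Adj i p.1 ∧ ¬ G'.Adj j p.2} :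
          Set (Fin n × Fin n)) with hX
  have hXc : X.ncard = X.toFinset.card := Set.ncard_eq_toFinset_card' X
  set A := (univ : Finset (Fin n × Fin n)).filter (fun p => G'.Adj p.1 p.2 ∧
    p.1 ∈ insert i (univ.filter (fun x => G'.Adj i x))) with hA
  set B := (univ : Finset (Fin n × Fin n)).filter (fun p => G'.Adj p.1 p.2 ∧
    p.2 ∈ insert j (univ.filter (fun x => G'.Adj j x))) with hB
  set C := (univ : Finset (Fin n × Fin n)).filter (fun p => G'.Adj p.1 p.2 ∧
    p.1 ∈ ({j} : Finset (Fin n))) with hC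
  set D := (univ : Finset (Fin n × Fin n)).filter (fun p => G'.Adj p.1 p.2 ∧
    p.2 ∈ ({i} : Finset (Fin n))) with hD
  have hsub : (univ : Finset (Fin n × Fin n)).filter (fun p => G'.Adj p.1 p.2 ∧
      p.1 ∈ (univ : Finset (Fin n))) ⊆ X.toFinset ∪ (A ∪ (B ∪ (C ∪ D))) := by
    intro p hp
    have hp1 : G'.Adj p.1 p.2 := (Finset.mem_filter.1 hp).2.1
    have hne := hp1.ne
    simp only [hX, hA, hB, hC, hD, Finset.mem_union, Set.mem_toFinset, Set.mem_setOf_eq,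
      Finset.mem_filter, Finset.mem_univ, true_and, Finset.mem_insert, Finset.mem_singleton]
    tauto
  have h0 := Finset.card_le_card hsub
  have h1 := Finset.card_union_le X.toFinset (A ∪ (B ∪ (C ∪ D)))
  have h2 := Finset.card_union_le A (B ∪ (C ∪ D))
  have h3 := Finset.card_union_le B (C ∪ D)
  have h4 := Finset.card_union_le C D
  have h5 := hΔ i
  have h6 := hΔ j
  omega
end
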